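/- arXiv:1703.06425 — 5 statements merged into one kernel-verified Lean document; each statement's English description precedes it below -/
import Mathlib

section
/- Let λ be an l-multipartition of n and let T be a row-strict, non-standard λ-tableau. Suppose (r,c,t) and (r+1,c,t) lie in [λ] and T(r,c,t) = T(r+1,c,t) + 1. Then with A := (r,c,t) there exists w ∈ S_n such that T = w g^A with ℓ(T) = ℓ(w) + ℓ(g^A), and s_p w = w s_q, where p = T(r+1,c,t) and q = g^A(r+1,c,t). -/
/-- A node `(r, c, t)` of (the Young diagram of) an `l`-multipartition: row `r`,
column `c`, component `t`, all 1-based. -/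
abbrev MNode : Type := ℕ × ℕ × ℕ

/-- The simple transposition `sᵢ = (i, i+1)`. -/
def sgen (i : ℕ) : Equiv.Perm ℕ := Equiv.swap i (i + 1)

/-- The Coxeter length of a permutation supported on `{1, …, n}`:
its number of inversions among `1, …, n`. -/
def invLen (n : ℕ) (w : Equiv.Perm ℕ) : ℕ :=
  ((Finset.Icc 1 n ×ˢ Finset.Icc 1 n).filter fun p => p.1 < p.2 ∧ w p.2 < w p.1).card

/-- `w` fixes every letter outside `{1, …, n}` (i.e. `w ∈ S_n`). -/
def FixOut (n : ℕ) (w : Equiv.Perm ℕ) : Prop := ∀ m, m ∉ Set.Icc 1 n → w m = m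

namespace MP

/-- `lam t r` is the length `λ^(t)_r` of the `r`-th row (1-based) of the `t`-th component
of an `l`-multipartition of `n`: each component is weakly decreasing, rows beyond the `n`-th
are empty, each row has length at most `n`, and the total number of boxes is `n`. -/
def IsMP (l n : ℕ) (lam : ℕ → ℕ → ℕ) : Prop :=
  (∀ t r, 1 ≤ r → lam t (r + 1) ≤ lam t r) ∧
  (∀ t r, n < r → lam t r = 0) ∧
  (∀ t r, lam t r ≤ n) ∧
  (∑ t ∈ Finset.Icc 1 l, ∑ r ∈ Finset.Icc 1 n, lam t r) = n

/-- The Young diagram `[λ]` of the multipartition. -/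
def diag (l : ℕ) (lam : ℕ → ℕ → ℕ) : Set MNode :=
  {x | 1 ≤ x.1 ∧ 1 ≤ x.2.1 ∧ 1 ≤ x.2.2 ∧ x.2.2 ≤ l ∧ x.2.1 ≤ lam x.2.2 x.1}

/-- A `λ`-tableau: a bijection `[λ] → {1, …, n}`. -/
def IsTab (l n : ℕ) (lam : ℕ → ℕ → ℕ) (T : MNode → ℕ) : Prop :=
  Set.BijOn T (diag l lam) (Set.Icc 1 n)

/-- Entries increase from left to right along the rows of each component. -/
def RowStrict (l : ℕ) (lam : ℕ → ℕ → ℕ) (T : MNode → ℕ) : Prop :=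
  ∀ r c t, (r, c, t) ∈ diag l lam → (r, c + 1, t) ∈ diag l lam →
    T (r, c, t) < T (r, c + 1, t)

/-- Entries increase down the columns of each component. -/
def ColStrict (l : ℕ) (lam : ℕ → ℕ → ℕ) (T : MNode → ℕ) : Prop :=
  ∀ r c t, (r, c, t) ∈ diag l lam → (r + 1, c, t) ∈ diag l lam →
    T (r, c, t) < T (r + 1, c, t)

/-- A standard `λ`-tableau. -/
def IsStd (l n : ℕ) (lam : ℕ → ℕ → ℕ) (T : MNode → ℕ) : Prop :=
  IsTab l n lam T ∧ RowStrict l lam T ∧ ColStrict l lam T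

/-- The initial tableau `t^λ`, filling `1, …, n` along successive rows of `λ^(1)`,
then of `λ^(2)`, and so on. -/
def itab (n : ℕ) (lam : ℕ → ℕ → ℕ) (x : MNode) : ℕ :=
  (∑ t' ∈ Finset.Ico 1 x.2.2, ∑ r' ∈ Finset.Icc 1 n, lam t' r') +
  (∑ r' ∈ Finset.Ico 1 x.1, lam x.2.2 r') + x.2.1

/-- `(r, c, t)` is a Garnir node of `[λ]`. -/
def IsGarnir (l : ℕ) (lam : ℕ → ℕ → ℕ) (r c t : ℕ) : Prop :=
  (r, c, t) ∈ diag l lam ∧ (r + 1, c, t) ∈ diag l lam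

/-- The Garnir belt `B^A` of the Garnir node `A = (r, c, t)`. -/
def belt (lam : ℕ → ℕ → ℕ) (r c t : ℕ) : Set MNode :=
  {x | (x.1 = r ∧ x.2.2 = t ∧ c ≤ x.2.1 ∧ x.2.1 ≤ lam t r) ∨
       (x.1 = r + 1 ∧ x.2.2 = t ∧ 1 ≤ x.2.1 ∧ x.2.1 ≤ c)}

/-- The Garnir tableau `g^A` of the Garnir node `A = (r, c, t)`: it agrees with `t^λ`
outside the Garnir belt, and the entries `u, …, v` (`u = t^λ(r,c,t)`, `v = t^λ(r+1,c,t)`)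
fill the belt in increasing order, first along row `r+1` and then along row `r`,
each from left to right. -/
def gtab (n : ℕ) (lam : ℕ → ℕ → ℕ) (r c t : ℕ) : MNode → ℕ := fun x =>
  if x.1 = r + 1 ∧ x.2.2 = t ∧ 1 ≤ x.2.1 ∧ x.2.1 ≤ c then
    itab n lam (r, c, t) + (x.2.1 - 1)
  else if x.1 = r ∧ x.2.2 = t ∧ c ≤ x.2.1 then
    itab n lam (r, c, t) + c + (x.2.1 - c)
  else itab n lam x

/-- `w` is the permutation `w^T` associated to the tableau `T`, i.e. `w ∈ S_n`
and `w t^λ = T`. -/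
def PermOf (l n : ℕ) (lam : ℕ → ℕ → ℕ) (T : MNode → ℕ) (w : Equiv.Perm ℕ) : Prop :=
  FixOut n w ∧ ∀ x ∈ diag l lam, w (itab n lam x) = T x

/-- The left (weak Bruhat) order: `v ≥_L w` iff `v = u w` with `ℓ(v) = ℓ(u) + ℓ(w)`. -/
def LeftGe (n : ℕ) (v w : Equiv.Perm ℕ) : Prop :=
  ∃ u : Equiv.Perm ℕ, FixOut n u ∧ v = u * w ∧ invLen n v = invLen n u + invLen n w

/-- The left order on `λ`-tableaux: `T ≥_L T'` iff `w^T ≥_L w^{T'}`. -/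
def TabGe (l n : ℕ) (lam : ℕ → ℕ → ℕ) (T T' : MNode → ℕ) : Prop :=
  ∃ wT wT' : Equiv.Perm ℕ, PermOf l n lam T wT ∧ PermOf l n lam T' wT' ∧ LeftGe n wT wT'

end MP

open MP

/-- A permutation fixing every letter outside `{1, …, n}` preserves `{1, …, n}`. -/
lemma FixOut.apply_mem {n : ℕ} {w : Equiv.Perm ℕ} (hw : FixOut n w) {m : ℕ}
    (hm : m ∈ Set.Icc 1 n) : w m ∈ Set.Icc 1 n := by
  by_contra h
  have := w.injective (hw _ h)
  exact h (by rwa [this])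

lemma FixOut.inv {n : ℕ} {w : Equiv.Perm ℕ} (hw : FixOut n w) : FixOut n w⁻¹ := fun m hm => by
  rw [Equiv.Perm.inv_eq_iff_eq, hw m hm]

lemma FixOut.mul {n : ℕ} {v w : Equiv.Perm ℕ} (hv : FixOut n v) (hw : FixOut n w) :
    FixOut n (v * w) := fun m hm => by
  rw [Equiv.Perm.mul_apply, hw m hm, hv m hm]

/-- Lengths add in a product `w * g` as soon as every inversion of `g` is one of `w * g`. -/
lemma invLen_mul_of_inversions_subset {n : ℕ} {w g : Equiv.Perm ℕ} (hg : FixOut n g)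
    (h : ∀ i ∈ Set.Icc 1 n, ∀ j ∈ Set.Icc 1 n, i < j → g j < g i → w (g j) < w (g i)) :
    invLen n (w * g) = invLen n w + invLen n g := by
  classical
  unfold invLen
  rw [← Finset.card_filter_add_card_filter_not (fun p : ℕ × ℕ => g p.1 < g p.2),
    Finset.filter_filter, Finset.filter_filter]
  congr 1
  · refine Finset.card_bij (fun p _ => (g p.1, g p.2)) ?_ ?_ ?_
    · rintro ⟨i, j⟩ hp
      simp only [Finset.mem_filter, Finset.mem_product, Finset.mem_Icc] at hp ⊢
      simp only [Equiv.Perm.mul_apply] at hp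
      exact ⟨⟨hg.apply_mem hp.1.1, hg.apply_mem hp.1.2⟩, hp.2.2, hp.2.1.2⟩
    · rintro ⟨i, j⟩ _ ⟨i', j'⟩ _ he
      simpa using he
    · rintro ⟨k, m⟩ hp
      simp only [Finset.mem_filter, Finset.mem_product, Finset.mem_Icc] at hp
      obtain ⟨⟨hk, hm⟩, hkm, hw⟩ := hp
      have hi := hg.inv.apply_mem hk
      have hj := hg.inv.apply_mem hm
      have hgi : g (g⁻¹ k) = k := g.apply_symm_apply k
      have hgj : g (g⁻¹ m) = m := g.apply_symm_apply m
      refine ⟨(g⁻¹ k, g⁻¹ m), ?_, by simp only [hgi, hgj]⟩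
      simp only [Finset.mem_filter, Finset.mem_product, Finset.mem_Icc]
      simp only [Equiv.Perm.mul_apply, hgi, hgj]
      refine ⟨⟨hi, hj⟩, ⟨?_, hw⟩, hkm⟩
      rcases lt_trichotomy (g⁻¹ k) (g⁻¹ m) with hlt | heq | hgt
      · exact hlt
      · exact absurd (g⁻¹.injective heq) hkm.ne
      · have := h _ hj _ hi hgt (by rwa [hgi, hgj])
        rw [hgi, hgj] at this
        omega
  · congr 1
    ext ⟨i, j⟩
    simp only [Finset.mem_filter, Finset.mem_product, Finset.mem_Icc]
    simp only [Equiv.Perm.mul_apply]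
    refine ⟨fun ⟨hm, hij, hn⟩ => ⟨hm, hij.1, ?_⟩, fun ⟨hm, hij, hn⟩ =>
      ⟨hm, ⟨hij, h i hm.1 j hm.2 hij hn⟩, by omega⟩⟩
    exact lt_of_le_of_ne (not_lt.mp hn) (fun he => hij.1.ne' (g.injective he))

namespace MP

lemma RowStrict.monotone {l : ℕ} {lam : ℕ → ℕ → ℕ} {T : MNode → ℕ} (hT : RowStrict l lam T)
    {r t a b : ℕ} (ha : (r, a, t) ∈ diag l lam) (hb : (r, b, t) ∈ diag l lam) (hab : a ≤ b) :
    T (r, a, t) ≤ T (r, b, t) := by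
  induction b, hab using Nat.le_induction with
  | base => exact le_rfl
  | succ b hab ih =>
    have hb' : (r, b, t) ∈ diag l lam := by
      simp only [diag, Set.mem_ofPred_eq] at ha hb ⊢
      omega
    exact (ih hb').trans (hT r b t hb' hb).le

lemma PermOf.injOn_itab {l n : ℕ} {lam : ℕ → ℕ → ℕ} {T : MNode → ℕ} {w : Equiv.Perm ℕ}
    (hw : PermOf l n lam T w) (hT : IsTab l n lam T) : Set.InjOn (itab n lam) (diag l lam) :=
  fun x hx y hy hxy => hT.injOn hx hy (by rw [← hw.2 x hx, ← hw.2 y hy, hxy])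

lemma PermOf.surjOn_itab {l n : ℕ} {lam : ℕ → ℕ → ℕ} {T : MNode → ℕ} {w : Equiv.Perm ℕ}
    (hw : PermOf l n lam T w) (hT : IsTab l n lam T) :
    Set.SurjOn (itab n lam) (diag l lam) (Set.Icc 1 n) := by
  intro i hi
  obtain ⟨x, hx, hxi⟩ := hT.surjOn (hw.1.apply_mem hi)
  exact ⟨x, hx, w.injective ((hw.2 x hx).trans hxi)⟩

lemma itab_row (n : ℕ) (lam : ℕ → ℕ → ℕ) (r t : ℕ) {a c : ℕ} (hca : c ≤ a) :
    itab n lam (r, a, t) = itab n lam (r, c, t) + (a - c) := by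
  simp only [itab]
  omega

lemma itab_next_row (n : ℕ) (lam : ℕ → ℕ → ℕ) {r t b c : ℕ} (hr : 1 ≤ r) (hc : c ≤ lam t r) :
    itab n lam (r + 1, b, t) = itab n lam (r, c, t) + (lam t r - c) + b := by
  simp only [itab, Finset.sum_Ico_succ_top hr]
  omega

lemma gtab_upper (n : ℕ) (lam : ℕ → ℕ → ℕ) (r t : ℕ) {a c : ℕ} (hca : c ≤ a) :
    gtab n lam r c t (r, a, t) = itab n lam (r, c, t) + a := by
  simp [gtab, hca]

lemma gtab_lower (n : ℕ) (lam : ℕ → ℕ → ℕ) (r t : ℕ) {b c : ℕ} (hb : 1 ≤ b) (hbc : b ≤ c) :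
    gtab n lam r c t (r + 1, b, t) = itab n lam (r, c, t) + (b - 1) := by
  simp [gtab, hb, hbc]

lemma gtab_of_notMem_belt {l n : ℕ} {lam : ℕ → ℕ → ℕ} {r c t : ℕ} {x : MNode}
    (hx : x ∈ diag l lam) (hxb : x ∉ belt lam r c t) :
    gtab n lam r c t x = itab n lam x := by
  obtain ⟨r', a, t'⟩ := x
  simp only [diag, belt, Set.mem_ofPred_eq, not_or] at hx hxb
  unfold gtab
  rw [if_neg (by tauto), if_neg]
  rintro ⟨rfl, rfl, h⟩
  exact hxb.1 ⟨rfl, rfl, h, hx.2.2.2.2⟩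

/-- The entries of the initial tableau outside a Garnir belt avoid the interval filled by it. -/
lemma itab_notMem_of_notMem_belt {l n : ℕ} {lam : ℕ → ℕ → ℕ} {r c t : ℕ}
    (hA : IsGarnir l lam r c t) (hinj : Set.InjOn (itab n lam) (diag l lam)) {x : MNode}
    (hx : x ∈ diag l lam) (hxb : x ∉ belt lam r c t) :
    itab n lam x < itab n lam (r, c, t) ∨ itab n lam (r, c, t) + lam t r < itab n lam x := by
  by_contra! h
  obtain ⟨h1, h2⟩ := hA
  simp only [diag, Set.mem_ofPred_eq] at h1 h2
  obtain ⟨d, hd⟩ := Nat.exists_eq_add_of_le h.1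
  by_cases hdc : c + d ≤ lam t r
  · have hy : (r, c + d, t) ∈ diag l lam := by
      simp only [diag, Set.mem_ofPred_eq]; omega
    have := hinj hx hy (by rw [itab_row n lam r t (Nat.le_add_right c d), hd]; omega)
    subst this
    exact hxb (.inl ⟨rfl, rfl, by dsimp only; omega, by dsimp only; omega⟩)
  · have hy : (r + 1, d - (lam t r - c), t) ∈ diag l lam := by
      simp only [diag, Set.mem_ofPred_eq]; omega
    have := hinj hx hy (by rw [itab_next_row n lam h1.1 h1.2.2.2.2, hd]; omega)
    subst this
    exact hxb (.inr ⟨rfl, rfl, by dsimp only; omega, by dsimp only; omega⟩)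

/-- The inversions of a Garnir tableau pair a node of the upper row of the belt
with a node of its lower row. -/
lemma inversion_gtab {l n : ℕ} {lam : ℕ → ℕ → ℕ} {r c t : ℕ}
    (hA : IsGarnir l lam r c t) (hinj : Set.InjOn (itab n lam) (diag l lam)) {x y : MNode}
    (hx : x ∈ diag l lam) (hy : y ∈ diag l lam) (hxy : itab n lam x < itab n lam y)
    (hg : gtab n lam r c t y < gtab n lam r c t x) :
    (∃ a, c ≤ a ∧ x = (r, a, t)) ∧ ∃ b, b ≤ c ∧ y = (r + 1, b, t) := by
  have key : ∀ z ∈ diag l lam,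
      (gtab n lam r c t z = itab n lam z ∧
        (itab n lam z < itab n lam (r, c, t) ∨ itab n lam (r, c, t) + lam t r < itab n lam z)) ∨
      (∃ a, c ≤ a ∧ a ≤ lam t r ∧ z = (r, a, t) ∧
        itab n lam z = itab n lam (r, c, t) + (a - c) ∧
        gtab n lam r c t z = itab n lam (r, c, t) + a) ∨
      (∃ b, 1 ≤ b ∧ b ≤ c ∧ z = (r + 1, b, t) ∧
        itab n lam z = itab n lam (r, c, t) + (lam t r - c) + b ∧
        gtab n lam r c t z = itab n lam (r, c, t) + (b - 1)) := by
    intro z hz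
    by_cases hzb : z ∈ belt lam r c t
    · obtain ⟨r', a, t'⟩ := z
      rcases hzb with ⟨h1, h2, h3, h4⟩ | ⟨h1, h2, h3, h4⟩ <;> dsimp only at h1 h2 h3 h4 <;>
        subst h1 h2
      · exact .inr (.inl ⟨a, h3, h4, rfl, itab_row n lam _ _ h3, gtab_upper n lam _ _ h3⟩)
      · exact .inr (.inr ⟨a, h3, h4, rfl, itab_next_row n lam hA.1.1 hA.1.2.2.2.2,
          gtab_lower n lam _ _ h3 h4⟩)
    · exact .inl ⟨gtab_of_notMem_belt hz hzb, itab_notMem_of_notMem_belt hA hinj hz hzb⟩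
  have hc : c ≤ lam t r := hA.1.2.2.2.2
  rcases key x hx with hx' | ⟨a, ha, ha', rfl, hx'⟩ | ⟨a, ha, ha', rfl, hx'⟩ <;>
    rcases key y hy with hy' | ⟨b, hb, hb', rfl, hy'⟩ | ⟨b, hb, hb', rfl, hy'⟩ <;>
    first
    | exact ⟨⟨a, ha, rfl⟩, b, hb', rfl⟩
    | omega

end MP

/-- Let `T` be a row-strict, non-standard `λ`-tableau with
`(r,c,t), (r+1,c,t) ∈ [λ]` and `T(r,c,t) = T(r+1,c,t) + 1`.  Then, with `A := (r,c,t)`,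
there is `w ∈ S_n` such that `T = w g^A` with `ℓ(T) = ℓ(w) + ℓ(g^A)`, and
`s_p w = w s_q` where `p = T(r+1,c,t)` and `q = g^A(r+1,c,t)`. -/
theorem stmt4 (l n : ℕ) (hl : 1 ≤ l) (lam : ℕ → ℕ → ℕ) (hMP : IsMP l n lam)
    (T : MNode → ℕ) (hTab : IsTab l n lam T) (hRow : RowStrict l lam T)
    (hNStd : ¬ IsStd l n lam T)
    (r c t : ℕ) (h1 : (r, c, t) ∈ diag l lam) (h2 : (r + 1, c, t) ∈ diag l lam)
    (hval : T (r, c, t) = T (r + 1, c, t) + 1)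
    (wT wG : Equiv.Perm ℕ)
    (hwT : PermOf l n lam T wT) (hwG : PermOf l n lam (gtab n lam r c t) wG) :
    ∃ w : Equiv.Perm ℕ, FixOut n w ∧
      (∀ x ∈ diag l lam, T x = w (gtab n lam r c t x)) ∧
      invLen n wT = invLen n w + invLen n wG ∧
      sgen (T (r + 1, c, t)) * w = w * sgen (gtab n lam r c t (r + 1, c, t)) := by
  have hc : 1 ≤ c := h1.2.1
  have hinj := hwT.injOn_itab hTab
  have hmul : wT * wG⁻¹ * wG = wT := inv_mul_cancel_right wT wG
  have hw : ∀ x ∈ diag l lam, T x = (wT * wG⁻¹) (gtab n lam r c t x) := fun x hx => by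
    rw [← hwG.2 x hx, ← Equiv.Perm.mul_apply, hmul, hwT.2 x hx]
  refine ⟨wT * wG⁻¹, hwT.1.mul hwG.1.inv, hw, ?_, ?_⟩
  · rw [← invLen_mul_of_inversions_subset hwG.1, hmul]
    intro i hi j hj hij hg
    rw [← Equiv.Perm.mul_apply, ← Equiv.Perm.mul_apply, hmul]
    obtain ⟨x, hx, rfl⟩ := hwT.surjOn_itab hTab hi
    obtain ⟨y, hy, rfl⟩ := hwT.surjOn_itab hTab hj
    rw [hwG.2 x hx, hwG.2 y hy] at hg
    rw [hwT.2 x hx, hwT.2 y hy]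
    obtain ⟨⟨a, ha, rfl⟩, b, hb, rfl⟩ := inversion_gtab ⟨h1, h2⟩ hinj hx hy hij hg
    have := hRow.monotone h1 hx ha
    have := hRow.monotone hy h2 hb
    omega
  · have hq : gtab n lam r c t (r, c, t) = gtab n lam r c t (r + 1, c, t) + 1 := by
      rw [gtab_upper n lam r t le_rfl, gtab_lower n lam r t hc le_rfl]
      omega
    rw [sgen, sgen, Equiv.mul_swap_eq_swap_mul, ← hq, ← hw _ h1, ← hw _ h2, hval]
end

section
/- Let A and B be distinct Garnir nodes of an l-multipartition λ of n. Then there is a unique row-strict, non-standard λ-tableau g^{A,B} such that: (1) g^{A,B} ≥_L g^A and g^{A,B} ≥_L g^B; and (2) every row-strict λ-tableau T with T ≥_L g^A and T ≥_L g^B satisfies T ≥_L g^{A,B}. -/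
open MP

namespace FixOut

theorem inv_s6 {n : ℕ} {w : Equiv.Perm ℕ} (hw : FixOut n w) : FixOut n w⁻¹ := by
  intro m hm
  rw [Equiv.Perm.inv_eq_iff_eq, hw m hm]

theorem mul_s6 {n : ℕ} {v w : Equiv.Perm ℕ} (hv : FixOut n v) (hw : FixOut n w) :
    FixOut n (v * w) := by
  intro m hm
  rw [Equiv.Perm.mul_apply, hw m hm, hv m hm]

theorem apply_mem_s6 {n : ℕ} {w : Equiv.Perm ℕ} (hw : FixOut n w) {m : ℕ}
    (hm : m ∈ Finset.Icc 1 n) : w m ∈ Finset.Icc 1 n := by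
  by_contra h
  rw [Finset.mem_Icc] at h
  have h' := hw (w m) (by rwa [Set.mem_Icc])
  rw [w.injective h'] at h
  exact h (Finset.mem_Icc.1 hm)

end FixOut

/-- The inversions of `w` that are undone by `u`. -/
def cancelledInversions (n : ℕ) (u w : Equiv.Perm ℕ) : Finset (ℕ × ℕ) :=
  (Finset.Icc 1 n ×ˢ Finset.Icc 1 n).filter fun p =>
    p.1 < p.2 ∧ w p.2 < w p.1 ∧ u (w p.1) < u (w p.2)

theorem invLen_mul_add (n : ℕ) (u w : Equiv.Perm ℕ) (hw : FixOut n w) :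
    invLen n (u * w) + 2 * (cancelledInversions n u w).card = invLen n u + invLen n w := by
  set S := Finset.Icc 1 n ×ˢ Finset.Icc 1 n with hS
  set P := S.filter fun p => p.1 < p.2 ∧ w p.1 < w p.2 ∧ u (w p.2) < u (w p.1) with hP
  set R := S.filter fun p => p.1 < p.2 ∧ w p.2 < w p.1 ∧ u (w p.2) < u (w p.1) with hR
  set Q := cancelledInversions n u w with hQ
  have hne : ∀ {a b : ℕ} (v : Equiv.Perm ℕ), a < b → v a < v b ∨ v b < v a := by
    intro a b v hab
    have : v a ≠ v b := fun h => hab.ne (v.injective h)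
    omega
  have hv : invLen n (u * w) = P.card + R.card := by
    rw [invLen, ← Finset.card_union_of_disjoint]
    · congr 1
      ext p
      rw [Finset.mem_filter, Equiv.Perm.mul_apply, Equiv.Perm.mul_apply]
      simp only [hP, hR, Finset.mem_filter, Finset.mem_union]
      have := @hne p.1 p.2 w
      tauto
    · rw [Finset.disjoint_left]
      intro p h1 h2
      simp only [hP, hR, Finset.mem_filter] at h1 h2
      omega
  have hwc : invLen n w = Q.card + R.card := by
    rw [invLen, ← Finset.card_union_of_disjoint]
    · congr 1
      ext p
      simp only [hQ, cancelledInversions, hR, Finset.mem_filter, Finset.mem_union]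
      have := @hne (w p.2) (w p.1) u
      tauto
    · rw [Finset.disjoint_left]
      intro p h1 h2
      simp only [hQ, cancelledInversions, hR, Finset.mem_filter] at h1 h2
      omega
  have hu : invLen n u = P.card + Q.card := by
    have h1 : P.card = (((S.filter fun p => p.1 < p.2 ∧ u p.2 < u p.1)).filter
        fun p => w⁻¹ p.1 < w⁻¹ p.2).card := by
      refine Finset.card_nbij' (fun p => (w p.1, w p.2)) (fun p => (w⁻¹ p.1, w⁻¹ p.2)) ?_ ?_ ?_ ?_
      · intro p hp
        simp only [hP, hS, Finset.coe_filter, Finset.mem_filter, Finset.mem_product, Set.mem_ofPred_eq] at hp ⊢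
        simp only [Equiv.Perm.coe_inv, Equiv.symm_apply_apply]
        exact ⟨⟨⟨hw.apply_mem_s6 hp.1.1, hw.apply_mem_s6 hp.1.2⟩, hp.2.2⟩, hp.2.1⟩
      · intro p hp
        simp only [hP, hS, Finset.coe_filter, Finset.mem_filter, Finset.mem_product, Set.mem_ofPred_eq] at hp ⊢
        simp only [Equiv.Perm.coe_inv, Equiv.apply_symm_apply]
        exact ⟨⟨hw.inv_s6.apply_mem_s6 hp.1.1.1, hw.inv_s6.apply_mem_s6 hp.1.1.2⟩, hp.2, hp.1.2⟩
      · intro p _; simp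
      · intro p _; simp
    have h2 : Q.card = (((S.filter fun p => p.1 < p.2 ∧ u p.2 < u p.1)).filter
        fun p => ¬ w⁻¹ p.1 < w⁻¹ p.2).card := by
      refine Finset.card_nbij' (fun p => (w p.2, w p.1)) (fun p => (w⁻¹ p.2, w⁻¹ p.1)) ?_ ?_ ?_ ?_
      · intro p hp
        simp only [hQ, cancelledInversions, hS, Finset.coe_filter, Finset.mem_filter, Finset.mem_product, Set.mem_ofPred_eq] at hp ⊢
        simp only [Equiv.Perm.coe_inv, Equiv.symm_apply_apply]
        exact ⟨⟨⟨hw.apply_mem_s6 hp.1.2, hw.apply_mem_s6 hp.1.1⟩, hp.2.2⟩, by omega⟩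
      · intro p hp
        simp only [hQ, cancelledInversions, hS, Finset.coe_filter, Finset.mem_filter, Finset.mem_product, Set.mem_ofPred_eq] at hp ⊢
        simp only [Equiv.Perm.coe_inv, Equiv.apply_symm_apply]
        have := hne w⁻¹ hp.1.2.1
        exact ⟨⟨hw.inv_s6.apply_mem_s6 hp.1.1.2, hw.inv_s6.apply_mem_s6 hp.1.1.1⟩, by tauto, hp.1.2⟩
      · intro p _; simp
      · intro p _; simp
    rw [invLen, h1, h2, Finset.card_filter_add_card_filter_not]
  omega

/-- The left order is containment of inversion sets. -/
theorem MP.leftGe_iff {n : ℕ} {v w : Equiv.Perm ℕ} (hv : FixOut n v) (hw : FixOut n w) :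
    LeftGe n v w ↔ ∀ i ∈ Finset.Icc 1 n, ∀ j ∈ Finset.Icc 1 n, i < j → w j < w i → v j < v i := by
  constructor
  · rintro ⟨u, -, rfl, hl⟩ i hi j hj hij hw'
    have h := invLen_mul_add n u w hw
    have h0 : cancelledInversions n u w = ∅ := by
      rw [← Finset.card_eq_zero]; omega
    by_contra hc
    have hne : u (w i) ≠ u (w j) := fun h => hij.ne (w.injective (u.injective h))
    rw [Equiv.Perm.mul_apply, Equiv.Perm.mul_apply] at hc
    have : (i, j) ∈ cancelledInversions n u w := by
      simp only [cancelledInversions, Finset.mem_filter, Finset.mem_product]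
      exact ⟨⟨hi, hj⟩, hij, hw', by omega⟩
    rw [h0] at this
    simp at this
  · intro h
    refine ⟨v * w⁻¹, hv.mul_s6 hw.inv_s6, by simp, ?_⟩
    have h1 := invLen_mul_add n (v * w⁻¹) w hw
    have h0 : cancelledInversions n (v * w⁻¹) w = ∅ := by
      rw [Finset.eq_empty_iff_forall_notMem]
      intro p hp
      simp only [cancelledInversions, Finset.mem_filter, Finset.mem_product, Equiv.Perm.mul_apply,
        Equiv.Perm.coe_inv, Equiv.symm_apply_apply] at hp
      have := h _ hp.1.1 _ hp.1.2 hp.2.1 hp.2.2.1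
      omega
    rw [h0] at h1
    simpa using h1

namespace MP

variable {l n : ℕ} {lam : ℕ → ℕ → ℕ}

/-- The Young diagram as a finset. -/
def diagFinset (l n : ℕ) (lam : ℕ → ℕ → ℕ) : Finset MNode :=
  (Finset.Icc 1 n ×ˢ Finset.Icc 1 n ×ˢ Finset.Icc 1 l).filter fun x => x.2.1 ≤ lam x.2.2 x.1

theorem IsMP.mem_diagFinset (h : IsMP l n lam) {x : MNode} :
    x ∈ diagFinset l n lam ↔ x ∈ diag l lam := by
  simp only [diagFinset, diag, Finset.mem_filter, Finset.mem_product, Finset.mem_Icc,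
    Set.mem_ofPred_eq]
  have h1 := h.2.1 x.2.2 x.1
  have h2 := h.2.2.1 x.2.2 x.1
  by_cases h3 : n < x.1
  · have := h1 h3; omega
  · omega

theorem IsMP.card_diagFinset (h : IsMP l n lam) : (diagFinset l n lam).card = n := by
  have hrow : ∀ t r, lam t r = ∑ c ∈ Finset.Icc 1 n, if c ≤ lam t r then 1 else 0 := by
    intro t r
    have : (Finset.Icc 1 n).filter (· ≤ lam t r) = Finset.Icc 1 (lam t r) := by
      ext c
      have := h.2.2.1 t r
      simp only [Finset.mem_filter, Finset.mem_Icc]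
      omega
    rw [← Finset.card_filter, this, Nat.card_Icc, Nat.add_sub_cancel]
  conv_rhs => rw [← h.2.2.2, Finset.sum_comm]
  simp_rw [diagFinset, Finset.card_filter, Finset.sum_product]
  refine Finset.sum_congr rfl fun r _ => ?_
  rw [Finset.sum_comm]
  exact Finset.sum_congr rfl fun t _ => (hrow t r).symm

/-- Reading order on nodes: along successive rows of successive components. -/
def ReadLt (x y : MNode) : Prop :=
  x.2.2 < y.2.2 ∨ x.2.2 = y.2.2 ∧ (x.1 < y.1 ∨ x.1 = y.1 ∧ x.2.1 < y.2.1)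

theorem readLt_or_eq_or_readLt (x y : MNode) : ReadLt x y ∨ x = y ∨ ReadLt y x := by
  obtain ⟨a, b, c⟩ := x
  obtain ⟨a', b', c'⟩ := y
  simp only [ReadLt, Prod.mk.injEq]
  omega

theorem sum_Ico_add_le (f : ℕ → ℕ) {a b : ℕ} (ha : 1 ≤ a) (hab : a < b) :
    ∑ i ∈ Finset.Ico 1 a, f i + f a ≤ ∑ i ∈ Finset.Ico 1 b, f i := by
  rw [← Finset.sum_Ico_succ_top ha]
  exact Finset.sum_le_sum_of_subset (Finset.Ico_subset_Ico_right hab)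

theorem IsMP.row_prefix_le (h : IsMP l n lam) {x : MNode} (hx : x ∈ diag l lam) :
    (∑ r' ∈ Finset.Ico 1 x.1, lam x.2.2 r') + x.2.1 ≤ ∑ r' ∈ Finset.Icc 1 n, lam x.2.2 r' := by
  have hx' := h.mem_diagFinset.2 hx
  simp only [diagFinset, Finset.mem_filter, Finset.mem_product, Finset.mem_Icc] at hx'
  have := sum_Ico_add_le (lam x.2.2) (a := x.1) (b := n + 1) (by omega) (by omega)
  rw [Finset.Ico_add_one_right_eq_Icc] at this
  omega

theorem IsMP.itab_lt (h : IsMP l n lam) {x y : MNode} (hx : x ∈ diag l lam)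
    (hy : y ∈ diag l lam) (hxy : ReadLt x y) : itab n lam x < itab n lam y := by
  have hpx := h.row_prefix_le hx
  obtain ⟨r, c, t⟩ := x
  obtain ⟨r', c', t'⟩ := y
  simp only [diag, Set.mem_ofPred_eq] at hx hy
  simp only [itab, ReadLt] at *
  rcases hxy with ht | ⟨rfl, hr | ⟨rfl, hc⟩⟩
  · have := sum_Ico_add_le (fun s => ∑ r' ∈ Finset.Icc 1 n, lam s r') hx.2.2.1 ht
    omega
  · have := sum_Ico_add_le (lam t) hx.1 hr
    omega
  · omega

theorem IsMP.itab_lt_iff (h : IsMP l n lam) {x y : MNode} (hx : x ∈ diag l lam)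
    (hy : y ∈ diag l lam) : itab n lam x < itab n lam y ↔ ReadLt x y := by
  refine ⟨fun hlt => ?_, h.itab_lt hx hy⟩
  rcases readLt_or_eq_or_readLt x y with h1 | rfl | h1
  · exact h1
  · omega
  · have := h.itab_lt hy hx h1
    omega

theorem IsMP.itab_le (h : IsMP l n lam) {x : MNode} (hx : x ∈ diag l lam) :
    itab n lam x ≤ n := by
  have hpx := h.row_prefix_le hx
  simp only [diag, Set.mem_ofPred_eq] at hx
  have := sum_Ico_add_le (fun s => ∑ r' ∈ Finset.Icc 1 n, lam s r') hx.2.2.1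
    (Nat.lt_succ_of_le hx.2.2.2.1)
  rw [Nat.succ_eq_add_one, Finset.Ico_add_one_right_eq_Icc, h.2.2.2] at this
  simp only [itab]
  omega

theorem IsMP.isTab_of_injOn (h : IsMP l n lam) {T : MNode → ℕ}
    (hmaps : ∀ x ∈ diag l lam, 1 ≤ T x ∧ T x ≤ n) (hinj : Set.InjOn T (diag l lam)) :
    IsTab l n lam T := by
  have hD : (diagFinset l n lam : Set MNode) = diag l lam := by
    ext x; rw [Finset.mem_coe, h.mem_diagFinset]
  refine ⟨hmaps, hinj, ?_⟩
  have := Finset.surjOn_of_injOn_of_card_le (s := diagFinset l n lam) (t := Finset.Icc 1 n) T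
    (by rw [hD, Finset.coe_Icc]; exact hmaps) (by rwa [hD])
    (by rw [h.card_diagFinset]; simp)
  rwa [hD, Finset.coe_Icc] at this

theorem IsMP.isTab_itab (h : IsMP l n lam) : IsTab l n lam (itab n lam) := by
  refine h.isTab_of_injOn (fun x hx => ⟨?_, h.itab_le hx⟩) fun x hx y hy hxy => ?_
  · simp only [diag, Set.mem_ofPred_eq, itab] at *
    omega
  · rcases readLt_or_eq_or_readLt x y with h1 | h1 | h1
    · have := h.itab_lt hx hy h1; omega
    · exact h1
    · have := h.itab_lt hy hx h1; omega

theorem IsMP.exists_permOf (h : IsMP l n lam) {T : MNode → ℕ} (hT : IsTab l n lam T) :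
    ∃ w, PermOf l n lam T w := by
  classical
  let e : Equiv.Perm (Set.Icc 1 n) := (Set.BijOn.equiv _ h.isTab_itab).symm.trans
    (Set.BijOn.equiv _ hT)
  refine ⟨Equiv.Perm.ofSubtype e, fun m hm => Equiv.Perm.ofSubtype_apply_of_not_mem e hm,
    fun x hx => ?_⟩
  have hm := h.isTab_itab.mapsTo hx
  rw [Equiv.Perm.ofSubtype_apply_of_mem e hm]
  have : (Set.BijOn.equiv _ h.isTab_itab).symm ⟨itab n lam x, hm⟩ = ⟨x, hx⟩ := by
    rw [Equiv.symm_apply_eq]; rfl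
  simp only [e, Equiv.trans_apply, this]
  rfl

theorem IsMP.tabGe_iff (h : IsMP l n lam) {T T' : MNode → ℕ} (hT : IsTab l n lam T)
    (hT' : IsTab l n lam T') : TabGe l n lam T T' ↔
      ∀ x ∈ diag l lam, ∀ y ∈ diag l lam, ReadLt x y → T' y < T' x → T y < T x := by
  have hI := h.isTab_itab
  constructor
  · rintro ⟨v, w, ⟨hv, hv'⟩, ⟨hw, hw'⟩, hvw⟩ x hx y hy hxy hlt
    rw [leftGe_iff hv hw] at hvw
    rw [← hv' x hx, ← hv' y hy]
    rw [← hw' x hx, ← hw' y hy] at hlt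
    exact hvw _ (Finset.mem_Icc.2 (hI.mapsTo hx)) _ (Finset.mem_Icc.2 (hI.mapsTo hy))
      (h.itab_lt hx hy hxy) hlt
  · intro H
    obtain ⟨v, hv, hv'⟩ := h.exists_permOf hT
    obtain ⟨w, hw, hw'⟩ := h.exists_permOf hT'
    refine ⟨v, w, ⟨hv, hv'⟩, ⟨hw, hw'⟩, ?_⟩
    rw [leftGe_iff hv hw]
    intro i hi j hj hij hlt
    obtain ⟨x, hx, rfl⟩ := hI.surjOn (Finset.mem_Icc.1 hi)
    obtain ⟨y, hy, rfl⟩ := hI.surjOn (Finset.mem_Icc.1 hj)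
    rw [hv' x hx, hv' y hy]
    rw [hw' x hx, hw' y hy] at hlt
    exact H x hx y hy ((h.itab_lt_iff hx hy).1 hij) hlt

theorem IsMP.tab_eq_card (h : IsMP l n lam) {T : MNode → ℕ} (hT : IsTab l n lam T)
    {x : MNode} (hx : x ∈ diag l lam) :
    ((diagFinset l n lam).filter fun y => T y ≤ T x).card = T x := by
  have hle := (hT.mapsTo hx).2
  rw [← Finset.card_image_of_injOn (f := T)]
  · conv_rhs => rw [← Nat.add_sub_cancel (T x) 1, ← Nat.card_Icc]
    congr 1
    ext m
    simp only [Finset.mem_image, Finset.mem_filter, h.mem_diagFinset, Finset.mem_Icc]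
    constructor
    · rintro ⟨y, ⟨hy, hyx⟩, rfl⟩
      exact ⟨(hT.mapsTo hy).1, hyx⟩
    · rintro ⟨h1, h2⟩
      obtain ⟨y, hy, rfl⟩ := hT.surjOn ⟨h1, h2.trans hle⟩
      exact ⟨y, ⟨hy, h2⟩, rfl⟩
  · intro y hy z hz hyz
    simp only [Finset.coe_filter, Set.mem_ofPred_eq, h.mem_diagFinset] at hy hz
    exact hT.injOn hy.1 hz.1 hyz

theorem IsMP.eqOn_of_tabGe (h : IsMP l n lam) {T T' : MNode → ℕ} (hT : IsTab l n lam T)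
    (hT' : IsTab l n lam T') (h1 : TabGe l n lam T T') (h2 : TabGe l n lam T' T) :
    Set.EqOn T T' (diag l lam) := by
  rw [h.tabGe_iff hT hT'] at h1
  rw [h.tabGe_iff hT' hT] at h2
  have key : ∀ x ∈ diag l lam, ∀ y ∈ diag l lam, ReadLt x y → (T y < T x ↔ T' y < T' x) :=
    fun x hx y hy hxy => ⟨h2 x hx y hy hxy, h1 x hx y hy hxy⟩
  intro x hx
  rw [← h.tab_eq_card hT hx, ← h.tab_eq_card hT' hx]
  congr 1
  refine Finset.filter_congr fun y hy => ?_
  rw [h.mem_diagFinset] at hy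
  rcases readLt_or_eq_or_readLt x y with h3 | rfl | h3
  · have := key x hx y hy h3
    have h4 : T x = T y → T' x = T' y := fun e => by rw [hT.injOn hx hy e]
    have h5 : T' x = T' y → T x = T y := fun e => by rw [hT'.injOn hx hy e]
    omega
  · simp
  · have := key y hy x hx h3
    omega

end MP

namespace MP

variable {l n : ℕ} {lam : ℕ → ℕ → ℕ}

theorem IsGarnir.itab_below {r c t : ℕ} (hA : IsGarnir l lam r c t) :
    itab n lam (r + 1, c, t) = itab n lam (r, c, t) + lam t r := by
  have hr : 1 ≤ r := hA.1.1
  simp only [itab]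
  rw [Finset.sum_Ico_succ_top hr]
  omega

theorem IsMP.gtab_cases (h : IsMP l n lam) {r c t : ℕ} (hA : IsGarnir l lam r c t) {x : MNode}
    (hx : x ∈ diag l lam) :
    (x.1 = r ∧ x.2.2 = t ∧ c ≤ x.2.1 ∧ x.2.1 ≤ lam t r ∧
      gtab n lam r c t x = itab n lam (r, c, t) + x.2.1) ∨
    (x.1 = r + 1 ∧ x.2.2 = t ∧ 1 ≤ x.2.1 ∧ x.2.1 ≤ c ∧
      gtab n lam r c t x + 1 = itab n lam (r, c, t) + x.2.1) ∨
    (gtab n lam r c t x = itab n lam x ∧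
      (ReadLt x (r, c, t) ∧ itab n lam x < itab n lam (r, c, t) ∨
        ReadLt (r + 1, c, t) x ∧ itab n lam (r, c, t) + lam t r < itab n lam x)) := by
  have hv := hA.itab_below (n := n)
  have hlt := h.itab_lt_iff hx hA.1
  have hgt := h.itab_lt_iff hA.2 hx
  rw [hv] at hgt
  rw [hlt, hgt]
  obtain ⟨a, b, s⟩ := x
  simp only [diag, Set.mem_ofPred_eq, IsGarnir, ReadLt, gtab] at *
  split_ifs with h1 h2
  · right; left; omega
  · obtain ⟨rfl, rfl, h3⟩ := h2
    left; omega
  · have := hA.1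
    right; right
    refine ⟨rfl, ?_⟩
    by_cases h3 : s = t
    · subst h3
      by_cases h4 : a = r
      · subst h4; omega
      · by_cases h5 : a = r + 1
        · subst h5; omega
        · omega
    · omega

theorem IsMP.isTab_gtab (h : IsMP l n lam) {r c t : ℕ} (hA : IsGarnir l lam r c t) :
    IsTab l n lam (gtab n lam r c t) := by
  have hv := hA.itab_below (n := n)
  have h1 := h.isTab_itab.mapsTo hA.1
  have h2 := h.isTab_itab.mapsTo hA.2
  simp only [Set.mem_Icc] at h1 h2
  have hcA : c ≤ lam t r := hA.1.2.2.2.2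
  refine h.isTab_of_injOn (fun x hx => ?_) fun x hx y hy hxy => ?_
  · have h3 := h.isTab_itab.mapsTo hx
    simp only [Set.mem_Icc] at h3
    rcases h.gtab_cases hA hx with h4 | h4 | h4 <;> omega
  · obtain ⟨a, b, s⟩ := x
    obtain ⟨a', b', s'⟩ := y
    have hinj := h.isTab_itab.injOn hx hy
    simp only [Prod.mk.injEq] at hinj ⊢
    have hxc := h.gtab_cases hA hx
    have hyc := h.gtab_cases hA hy
    dsimp only at hxc hyc
    rcases hxc with h4 | h4 | h4 <;> rcases hyc with h5 | h5 | h5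
    all_goals omega

theorem RowStrict.lt {T : MNode → ℕ} (hT : RowStrict l lam T) {r a b t : ℕ}
    (ha : (r, a, t) ∈ diag l lam) (hb : (r, b, t) ∈ diag l lam) (hab : a < b) :
    T (r, a, t) < T (r, b, t) := by
  induction b, hab using Nat.le_induction with
  | base => exact hT r a t ha hb
  | succ b hab ih =>
    have hb' : (r, b, t) ∈ diag l lam := by
      simp only [diag, Set.mem_ofPred_eq] at *
      omega
    exact (ih hb').trans (hT r b t hb' hb)

theorem RowStrict.le {T : MNode → ℕ} (hT : RowStrict l lam T) {r a b t : ℕ}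
    (ha : (r, a, t) ∈ diag l lam) (hb : (r, b, t) ∈ diag l lam) (hab : a ≤ b) :
    T (r, a, t) ≤ T (r, b, t) := by
  rcases hab.eq_or_lt with rfl | hab
  · rfl
  · exact (hT.lt ha hb hab).le

theorem RowStrict.lt_of_garnir {T : MNode → ℕ} (hT : RowStrict l lam T) {r c t a b : ℕ}
    (hA : IsGarnir l lam r c t) (hTA : T (r + 1, c, t) < T (r, c, t))
    (ha : (r, a, t) ∈ diag l lam) (hb : (r + 1, b, t) ∈ diag l lam) (hca : c ≤ a) (hbc : b ≤ c) :
    T (r + 1, b, t) < T (r, a, t) :=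
  ((hT.le hb hA.2 hbc).trans_lt hTA).trans_le (hT.le hA.1 ha hca)

/-- A row-strict tableau lies above `g^A` iff its entry at `A` exceeds the one just below. -/
theorem IsMP.tabGe_gtab_iff (h : IsMP l n lam) {r c t : ℕ} (hA : IsGarnir l lam r c t)
    {T : MNode → ℕ} (hT : IsTab l n lam T) (hrs : RowStrict l lam T) :
    TabGe l n lam T (gtab n lam r c t) ↔ T (r + 1, c, t) < T (r, c, t) := by
  rw [h.tabGe_iff hT (h.isTab_gtab hA)]
  constructor
  · intro H
    refine H _ hA.1 _ hA.2 (by simp [ReadLt]) ?_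
    have h1 : 1 ≤ c := hA.1.2.1
    simp [gtab, h1]
    omega
  · intro hTA x hx y hy hxy hlt
    have h0 := h.itab_lt hx hy hxy
    have hcA : c ≤ lam t r := hA.1.2.2.2.2
    obtain ⟨a, b, s⟩ := x
    obtain ⟨a', b', s'⟩ := y
    have : a = r ∧ s = t ∧ c ≤ b ∧ a' = r + 1 ∧ s' = t ∧ b' ≤ c := by
      have hxc := h.gtab_cases hA hx
      have hyc := h.gtab_cases hA hy
      simp only [ReadLt] at hxy hxc hyc
      rcases hxc with h4 | h4 | h4 <;> rcases hyc with h5 | h5 | h5 <;> omega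
    obtain ⟨rfl, rfl, h1, rfl, rfl, h2⟩ := this
    exact hrs.lt_of_garnir hA hTA hx hy h1 h2

/-- Nodes sorted by component, then by the value of `b`, then by the reading order. -/
def blockKey (b : MNode → ℕ) (x : MNode) : ℕ ×ₗ ℕ ×ₗ ℕ ×ₗ ℕ :=
  toLex (x.2.2, toLex (b x, toLex (x.1, x.2.1)))

theorem blockKey_lt_iff (b : MNode → ℕ) (x y : MNode) : blockKey b x < blockKey b y ↔
    x.2.2 < y.2.2 ∨ x.2.2 = y.2.2 ∧ (b x < b y ∨ b x = b y ∧
      (x.1 < y.1 ∨ x.1 = y.1 ∧ x.2.1 < y.2.1)) := by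
  simp [blockKey, Prod.Lex.toLex_lt_toLex]

theorem blockKey_injective (b : MNode → ℕ) : Function.Injective (blockKey b) := by
  rintro ⟨r, c, t⟩ ⟨r', c', t'⟩ h
  simp [blockKey] at h
  simp [h]

/-- The tableau listing the nodes of the diagram in increasing order of their keys. -/
def rankTab {α : Type*} [LinearOrder α] (l n : ℕ) (lam : ℕ → ℕ → ℕ) (f : MNode → α)
    (x : MNode) : ℕ :=
  ((diagFinset l n lam).filter fun y => f y ≤ f x).card

section rankTab

variable {α : Type*} [LinearOrder α] {f : MNode → α}

theorem IsMP.rankTab_lt (h : IsMP l n lam) {x y : MNode} (hy : y ∈ diag l lam)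
    (hxy : f x < f y) : rankTab l n lam f x < rankTab l n lam f y := by
  refine Finset.card_lt_card ⟨fun z hz => ?_, fun hsub => ?_⟩
  · rw [Finset.mem_filter] at hz ⊢
    exact ⟨hz.1, hz.2.trans hxy.le⟩
  · have := hsub (Finset.mem_filter.2 ⟨h.mem_diagFinset.2 hy, le_rfl⟩)
    exact (Finset.mem_filter.1 this).2.not_gt hxy

theorem IsMP.rankTab_lt_iff (h : IsMP l n lam) (hf : Function.Injective f) {x y : MNode}
    (hx : x ∈ diag l lam) (hy : y ∈ diag l lam) :
    rankTab l n lam f x < rankTab l n lam f y ↔ f x < f y := by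
  refine ⟨fun hlt => ?_, h.rankTab_lt hy⟩
  rcases lt_trichotomy (f x) (f y) with h1 | h1 | h1
  · exact h1
  · rw [hf h1] at hlt
    exact absurd hlt (lt_irrefl _)
  · exact absurd (h.rankTab_lt hx h1) hlt.not_gt

theorem IsMP.isTab_rankTab (h : IsMP l n lam) (hf : Function.Injective f) :
    IsTab l n lam (rankTab l n lam f) := by
  refine h.isTab_of_injOn (fun x hx => ⟨?_, ?_⟩) fun x hx y hy hxy => ?_
  · exact Finset.card_pos.2 ⟨x, Finset.mem_filter.2 ⟨h.mem_diagFinset.2 hx, le_rfl⟩⟩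
  · exact (Finset.card_filter_le _ _).trans_eq h.card_diagFinset
  · rcases lt_trichotomy (f x) (f y) with h1 | h1 | h1
    · exact absurd hxy (h.rankTab_lt hy h1).ne
    · exact hf h1
    · exact absurd hxy (h.rankTab_lt hx h1).ne'

end rankTab

/-- Sorting nodes by `blockKey b` gives the least row-strict tableau above `g^A` and `g^B`,
where `A = (r, c, t)` and `B = (r', c', t')`. -/
structure IsJoinKey (l : ℕ) (lam : ℕ → ℕ → ℕ) (r c t r' c' t' : ℕ) (b : MNode → ℕ) : Prop where
  row : ∀ i j s, blockKey b (i, j, s) < blockKey b (i, j + 1, s)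
  left : blockKey b (r + 1, c, t) < blockKey b (r, c, t)
  right : blockKey b (r' + 1, c', t') < blockKey b (r', c', t')
  least : ∀ T : MNode → ℕ, RowStrict l lam T → T (r + 1, c, t) < T (r, c, t) →
    T (r' + 1, c', t') < T (r', c', t') → ∀ x ∈ diag l lam, ∀ y ∈ diag l lam,
    ReadLt x y → blockKey b y < blockKey b x → T y < T x

theorem IsJoinKey.symm {r c t r' c' t' : ℕ} {b : MNode → ℕ}
    (h : IsJoinKey l lam r c t r' c' t' b) : IsJoinKey l lam r' c' t' r c t b :=
  ⟨h.row, h.right, h.left, fun T hT h1 h2 => h.least T hT h2 h1⟩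

set_option maxHeartbeats 1000000 in
theorem isJoinKey_same_row {r c t c' : ℕ} (hA : IsGarnir l lam r c t)
    (hB : IsGarnir l lam r c' t) (hc : c < c') :
    IsJoinKey l lam r c t r c' t fun x =>
      if x.2.2 = t ∧ x.1 = r ∧ c' ≤ x.2.1 then 10 * (r + 1) + 3
      else if x.2.2 = t ∧ x.1 = r ∧ c ≤ x.2.1 then 10 * (r + 1) + 1
      else if x.2.2 = t ∧ x.1 = r + 1 ∧ c' < x.2.1 then 10 * (r + 1) + 4
      else if x.2.2 = t ∧ x.1 = r + 1 ∧ c < x.2.1 then 10 * (r + 1) + 2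
      else 10 * x.1 := by
  generalize hbx : (fun x : MNode =>
      if x.2.2 = t ∧ x.1 = r ∧ c' ≤ x.2.1 then 10 * (r + 1) + 3
      else if x.2.2 = t ∧ x.1 = r ∧ c ≤ x.2.1 then 10 * (r + 1) + 1
      else if x.2.2 = t ∧ x.1 = r + 1 ∧ c' < x.2.1 then 10 * (r + 1) + 4
      else if x.2.2 = t ∧ x.1 = r + 1 ∧ c < x.2.1 then 10 * (r + 1) + 2
      else 10 * x.1) = b
  have hb : ∀ i j s,
      s = t ∧ i = r ∧ c' ≤ j ∧ b (i, j, s) = 10 * (r + 1) + 3 ∨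
      s = t ∧ i = r ∧ c ≤ j ∧ j < c' ∧ b (i, j, s) = 10 * (r + 1) + 1 ∨
      s = t ∧ i = r ∧ j < c ∧ b (i, j, s) = 10 * r ∨
      s = t ∧ i = r + 1 ∧ c' < j ∧ b (i, j, s) = 10 * (r + 1) + 4 ∨
      s = t ∧ i = r + 1 ∧ c < j ∧ j ≤ c' ∧ b (i, j, s) = 10 * (r + 1) + 2 ∨
      s = t ∧ i = r + 1 ∧ j ≤ c ∧ b (i, j, s) = 10 * (r + 1) ∨
      (s ≠ t ∨ i < r ∨ r + 1 < i) ∧ b (i, j, s) = 10 * i := by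
    intro i j s
    subst hbx
    dsimp only
    split_ifs <;> grind
  clear hbx
  have hinv : ∀ i j i' j' s, i < i' ∨ i = i' ∧ j < j' →
      b (i', j', s) < b (i, j, s) ∨ b (i', j', s) = b (i, j, s) ∧ (i' < i ∨ i' = i ∧ j' < j) →
      i = r ∧ i' = r + 1 ∧ s = t ∧ (c ≤ j ∧ j' ≤ c ∨ c' ≤ j ∧ j' ≤ c') := by
    intro i j i' j' s
    rcases hb i j s with h1 | h1 | h1 | h1 | h1 | h1 | h1 <;>
      rcases hb i' j' s with h2 | h2 | h2 | h2 | h2 | h2 | h2 <;> omega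
  refine ⟨fun i j s => ?_, ?_, ?_, ?_⟩
  · simp only [blockKey_lt_iff, true_and, lt_irrefl, false_or]
    rcases hb i j s with h1 | h1 | h1 | h1 | h1 | h1 | h1 <;>
      rcases hb i (j + 1) s with h2 | h2 | h2 | h2 | h2 | h2 | h2 <;> omega
  · simp only [blockKey_lt_iff, true_and, lt_irrefl, false_or]
    have h1 := hb (r + 1) c t
    have h2 := hb r c t
    omega
  · simp only [blockKey_lt_iff, true_and, lt_irrefl, false_or]
    have h1 := hb (r + 1) c' t
    have h2 := hb r c' t
    omega
  · rintro T hT hTA hTB ⟨i, j, s⟩ hx ⟨i', j', s'⟩ hy hxy hlt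
    simp only [blockKey_lt_iff, ReadLt] at hlt hxy
    obtain rfl : s = s' := by omega
    simp only [lt_irrefl, true_and, false_or] at hlt hxy
    obtain ⟨rfl, rfl, rfl, ⟨h1, h2⟩ | ⟨h1, h2⟩⟩ := hinv i j i' j' s hxy hlt
    · exact hT.lt_of_garnir hA hTA hx hy h1 h2
    · exact hT.lt_of_garnir hB hTB hx hy h1 h2

set_option maxHeartbeats 1000000 in
theorem isJoinKey_next_row {r c t c' : ℕ} (hA : IsGarnir l lam r c t)
    (hB : IsGarnir l lam (r + 1) c' t) (hc : c' ≤ c) :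
    IsJoinKey l lam r c t (r + 1) c' t fun x =>
      if x.2.2 = t ∧ x.1 = r ∧ c ≤ x.2.1 then 10 * (r + 2) + 2
      else if x.2.2 = t ∧ x.1 = r + 1 ∧ c < x.2.1 then 10 * (r + 2) + 3
      else if x.2.2 = t ∧ x.1 = r + 1 ∧ c' ≤ x.2.1 then 10 * (r + 2) + 1
      else if x.2.2 = t ∧ x.1 = r + 2 ∧ c' < x.2.1 then 10 * (r + 2) + 4
      else 10 * x.1 := by
  generalize hbx : (fun x : MNode =>
      if x.2.2 = t ∧ x.1 = r ∧ c ≤ x.2.1 then 10 * (r + 2) + 2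
      else if x.2.2 = t ∧ x.1 = r + 1 ∧ c < x.2.1 then 10 * (r + 2) + 3
      else if x.2.2 = t ∧ x.1 = r + 1 ∧ c' ≤ x.2.1 then 10 * (r + 2) + 1
      else if x.2.2 = t ∧ x.1 = r + 2 ∧ c' < x.2.1 then 10 * (r + 2) + 4
      else 10 * x.1) = b
  have hb : ∀ i j s,
      s = t ∧ i = r ∧ c ≤ j ∧ b (i, j, s) = 10 * (r + 2) + 2 ∨
      s = t ∧ i = r ∧ j < c ∧ b (i, j, s) = 10 * r ∨
      s = t ∧ i = r + 1 ∧ c < j ∧ b (i, j, s) = 10 * (r + 2) + 3 ∨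
      s = t ∧ i = r + 1 ∧ c' ≤ j ∧ j ≤ c ∧ b (i, j, s) = 10 * (r + 2) + 1 ∨
      s = t ∧ i = r + 1 ∧ j < c' ∧ b (i, j, s) = 10 * (r + 1) ∨
      s = t ∧ i = r + 2 ∧ c' < j ∧ b (i, j, s) = 10 * (r + 2) + 4 ∨
      s = t ∧ i = r + 2 ∧ j ≤ c' ∧ b (i, j, s) = 10 * (r + 2) ∨
      (s ≠ t ∨ i < r ∨ r + 2 < i) ∧ b (i, j, s) = 10 * i := by
    intro i j s
    subst hbx
    dsimp only
    split_ifs <;> grind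
  clear hbx
  have hinv : ∀ i j i' j' s, i < i' ∨ i = i' ∧ j < j' →
      b (i', j', s) < b (i, j, s) ∨ b (i', j', s) = b (i, j, s) ∧ (i' < i ∨ i' = i ∧ j' < j) →
      s = t ∧ (i = r ∧ i' = r + 1 ∧ c ≤ j ∧ j' ≤ c ∨
        i = r + 1 ∧ i' = r + 2 ∧ c' ≤ j ∧ j' ≤ c' ∨ i = r ∧ i' = r + 2 ∧ c ≤ j ∧ j' ≤ c') := by
    intro i j i' j' s
    rcases hb i j s with h1 | h1 | h1 | h1 | h1 | h1 | h1 | h1 <;>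
      rcases hb i' j' s with h2 | h2 | h2 | h2 | h2 | h2 | h2 | h2 <;> omega
  refine ⟨fun i j s => ?_, ?_, ?_, ?_⟩
  · simp only [blockKey_lt_iff, true_and, lt_irrefl, false_or]
    rcases hb i j s with h1 | h1 | h1 | h1 | h1 | h1 | h1 | h1 <;>
      rcases hb i (j + 1) s with h2 | h2 | h2 | h2 | h2 | h2 | h2 | h2 <;> omega
  · simp only [blockKey_lt_iff, true_and, lt_irrefl, false_or]
    have h1 := hb (r + 1) c t
    have h2 := hb r c t
    omega
  · simp only [blockKey_lt_iff, true_and, lt_irrefl, false_or]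
    have h1 := hb ((r + 1) + 1) c' t
    have h2 := hb (r + 1) c' t
    omega
  · rintro T hT hTA hTB ⟨i, j, s⟩ hx ⟨i', j', s'⟩ hy hxy hlt
    simp only [blockKey_lt_iff, ReadLt] at hlt hxy
    obtain rfl : s = s' := by omega
    simp only [lt_irrefl, true_and, false_or] at hlt hxy
    obtain ⟨rfl, ⟨rfl, rfl, h1, h2⟩ | ⟨rfl, rfl, h1, h2⟩ | ⟨rfl, rfl, h1, h2⟩⟩ :=
      hinv i j i' j' s hxy hlt
    · exact hT.lt_of_garnir hA hTA hx hy h1 h2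
    · exact hT.lt_of_garnir hB hTB hx hy h1 h2
    · exact (hT.lt_of_garnir hB hTB hA.2 hy hc h2).trans
        (hT.lt_of_garnir hA hTA hx hA.2 h1 le_rfl)

set_option maxHeartbeats 1000000 in
theorem isJoinKey_lower_row {r c t r' c' : ℕ} (hA : IsGarnir l lam r c t)
    (hB : IsGarnir l lam r' c' t) (hr : r + 1 < r' ∨ r' = r + 1 ∧ c < c') :
    IsJoinKey l lam r c t r' c' t fun x =>
      if x.2.2 = t ∧ x.1 = r' ∧ c' ≤ x.2.1 then 10 * (r' + 1) + 1
      else if x.2.2 = t ∧ x.1 = r' + 1 ∧ c' < x.2.1 then 10 * (r' + 1) + 2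
      else if x.2.2 = t ∧ x.1 = r ∧ c ≤ x.2.1 then 10 * (r + 1) + 1
      else if x.2.2 = t ∧ x.1 = r + 1 ∧ c < x.2.1 then 10 * (r + 1) + 2
      else 10 * x.1 := by
  generalize hbx : (fun x : MNode =>
      if x.2.2 = t ∧ x.1 = r' ∧ c' ≤ x.2.1 then 10 * (r' + 1) + 1
      else if x.2.2 = t ∧ x.1 = r' + 1 ∧ c' < x.2.1 then 10 * (r' + 1) + 2
      else if x.2.2 = t ∧ x.1 = r ∧ c ≤ x.2.1 then 10 * (r + 1) + 1
      else if x.2.2 = t ∧ x.1 = r + 1 ∧ c < x.2.1 then 10 * (r + 1) + 2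
      else 10 * x.1) = b
  have hb : ∀ i j s,
      s = t ∧ i = r' ∧ c' ≤ j ∧ b (i, j, s) = 10 * (r' + 1) + 1 ∨
      s = t ∧ i = r' + 1 ∧ c' < j ∧ b (i, j, s) = 10 * (r' + 1) + 2 ∨
      s = t ∧ i = r' + 1 ∧ j ≤ c' ∧ b (i, j, s) = 10 * (r' + 1) ∨
      s = t ∧ i = r ∧ c ≤ j ∧ b (i, j, s) = 10 * (r + 1) + 1 ∨
      s = t ∧ i = r ∧ j < c ∧ b (i, j, s) = 10 * r ∨
      s = t ∧ i = r + 1 ∧ c < j ∧ (i < r' ∨ j < c') ∧ b (i, j, s) = 10 * (r + 1) + 2 ∨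
      s = t ∧ i = r + 1 ∧ j ≤ c ∧ b (i, j, s) = 10 * (r + 1) ∨
      s = t ∧ i = r' ∧ r + 1 < i ∧ j < c' ∧ b (i, j, s) = 10 * r' ∨
      (s ≠ t ∨ i < r ∨ r + 1 < i ∧ i < r' ∨ r' + 1 < i) ∧ b (i, j, s) = 10 * i := by
    intro i j s
    subst hbx
    dsimp only
    split_ifs <;> grind
  clear hbx
  have hinv : ∀ i j i' j' s, i < i' ∨ i = i' ∧ j < j' →
      b (i', j', s) < b (i, j, s) ∨ b (i', j', s) = b (i, j, s) ∧ (i' < i ∨ i' = i ∧ j' < j) →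
      s = t ∧ (i = r ∧ i' = r + 1 ∧ c ≤ j ∧ j' ≤ c ∨
        i = r' ∧ i' = r' + 1 ∧ c' ≤ j ∧ j' ≤ c') := by
    intro i j i' j' s
    rcases hb i j s with h1 | h1 | h1 | h1 | h1 | h1 | h1 | h1 | h1 <;>
      rcases hb i' j' s with h2 | h2 | h2 | h2 | h2 | h2 | h2 | h2 | h2 <;> omega
  refine ⟨fun i j s => ?_, ?_, ?_, ?_⟩
  · simp only [blockKey_lt_iff, true_and, lt_irrefl, false_or]
    rcases hb i j s with h1 | h1 | h1 | h1 | h1 | h1 | h1 | h1 | h1 <;>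
      rcases hb i (j + 1) s with h2 | h2 | h2 | h2 | h2 | h2 | h2 | h2 | h2 <;> omega
  · simp only [blockKey_lt_iff, true_and, lt_irrefl, false_or]
    have h1 := hb (r + 1) c t
    have h2 := hb r c t
    omega
  · simp only [blockKey_lt_iff, true_and, lt_irrefl, false_or]
    have h1 := hb (r' + 1) c' t
    have h2 := hb r' c' t
    omega
  · rintro T hT hTA hTB ⟨i, j, s⟩ hx ⟨i', j', s'⟩ hy hxy hlt
    simp only [blockKey_lt_iff, ReadLt] at hlt hxy
    obtain rfl : s = s' := by omega
    simp only [lt_irrefl, true_and, false_or] at hlt hxy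
    obtain ⟨rfl, ⟨rfl, rfl, h1, h2⟩ | ⟨rfl, rfl, h1, h2⟩⟩ := hinv i j i' j' s hxy hlt
    · exact hT.lt_of_garnir hA hTA hx hy h1 h2
    · exact hT.lt_of_garnir hB hTB hx hy h1 h2

set_option maxHeartbeats 1000000 in
theorem isJoinKey_of_component_ne {r c t r' c' t' : ℕ} (hA : IsGarnir l lam r c t)
    (hB : IsGarnir l lam r' c' t') (ht : t ≠ t') :
    IsJoinKey l lam r c t r' c' t' fun x =>
      if x.2.2 = t' ∧ x.1 = r' ∧ c' ≤ x.2.1 then 10 * (r' + 1) + 1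
      else if x.2.2 = t' ∧ x.1 = r' + 1 ∧ c' < x.2.1 then 10 * (r' + 1) + 2
      else if x.2.2 = t ∧ x.1 = r ∧ c ≤ x.2.1 then 10 * (r + 1) + 1
      else if x.2.2 = t ∧ x.1 = r + 1 ∧ c < x.2.1 then 10 * (r + 1) + 2
      else 10 * x.1 := by
  generalize hbx : (fun x : MNode =>
      if x.2.2 = t' ∧ x.1 = r' ∧ c' ≤ x.2.1 then 10 * (r' + 1) + 1
      else if x.2.2 = t' ∧ x.1 = r' + 1 ∧ c' < x.2.1 then 10 * (r' + 1) + 2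
      else if x.2.2 = t ∧ x.1 = r ∧ c ≤ x.2.1 then 10 * (r + 1) + 1
      else if x.2.2 = t ∧ x.1 = r + 1 ∧ c < x.2.1 then 10 * (r + 1) + 2
      else 10 * x.1) = b
  have hb : ∀ i j s,
      s = t' ∧ i = r' ∧ c' ≤ j ∧ b (i, j, s) = 10 * (r' + 1) + 1 ∨
      s = t' ∧ i = r' ∧ j < c' ∧ b (i, j, s) = 10 * r' ∨
      s = t' ∧ i = r' + 1 ∧ c' < j ∧ b (i, j, s) = 10 * (r' + 1) + 2 ∨
      s = t' ∧ i = r' + 1 ∧ j ≤ c' ∧ b (i, j, s) = 10 * (r' + 1) ∨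
      s = t ∧ i = r ∧ c ≤ j ∧ b (i, j, s) = 10 * (r + 1) + 1 ∨
      s = t ∧ i = r ∧ j < c ∧ b (i, j, s) = 10 * r ∨
      s = t ∧ i = r + 1 ∧ c < j ∧ b (i, j, s) = 10 * (r + 1) + 2 ∨
      s = t ∧ i = r + 1 ∧ j ≤ c ∧ b (i, j, s) = 10 * (r + 1) ∨
      (s ≠ t ∨ i < r ∨ r + 1 < i) ∧ (s ≠ t' ∨ i < r' ∨ r' + 1 < i) ∧ b (i, j, s) = 10 * i := by
    intro i j s
    subst hbx
    dsimp only
    split_ifs <;> grind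
  clear hbx
  have hinv : ∀ i j i' j' s, i < i' ∨ i = i' ∧ j < j' →
      b (i', j', s) < b (i, j, s) ∨ b (i', j', s) = b (i, j, s) ∧ (i' < i ∨ i' = i ∧ j' < j) →
      (s = t ∧ i = r ∧ i' = r + 1 ∧ c ≤ j ∧ j' ≤ c) ∨
        (s = t' ∧ i = r' ∧ i' = r' + 1 ∧ c' ≤ j ∧ j' ≤ c') := by
    intro i j i' j' s
    rcases hb i j s with h1 | h1 | h1 | h1 | h1 | h1 | h1 | h1 | h1 <;>
      rcases hb i' j' s with h2 | h2 | h2 | h2 | h2 | h2 | h2 | h2 | h2 <;> omega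
  refine ⟨fun i j s => ?_, ?_, ?_, ?_⟩
  · simp only [blockKey_lt_iff, true_and, lt_irrefl, false_or]
    rcases hb i j s with h1 | h1 | h1 | h1 | h1 | h1 | h1 | h1 | h1 <;>
      rcases hb i (j + 1) s with h2 | h2 | h2 | h2 | h2 | h2 | h2 | h2 | h2 <;> omega
  · simp only [blockKey_lt_iff, true_and, lt_irrefl, false_or]
    have h1 := hb (r + 1) c t
    have h2 := hb r c t
    omega
  · simp only [blockKey_lt_iff, true_and, lt_irrefl, false_or]
    have h1 := hb (r' + 1) c' t'
    have h2 := hb r' c' t'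
    omega
  · rintro T hT hTA hTB ⟨i, j, s⟩ hx ⟨i', j', s'⟩ hy hxy hlt
    simp only [blockKey_lt_iff, ReadLt] at hlt hxy
    obtain rfl : s = s' := by omega
    simp only [lt_irrefl, true_and, false_or] at hlt hxy
    obtain ⟨rfl, rfl, rfl, h1, h2⟩ | ⟨rfl, rfl, rfl, h1, h2⟩ := hinv i j i' j' s hxy hlt
    · exact hT.lt_of_garnir hA hTA hx hy h1 h2
    · exact hT.lt_of_garnir hB hTB hx hy h1 h2

theorem exists_isJoinKey {r c t r' c' t' : ℕ} (hA : IsGarnir l lam r c t)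
    (hB : IsGarnir l lam r' c' t') (hne : (r, c, t) ≠ (r', c', t')) :
    ∃ b, IsJoinKey l lam r c t r' c' t' b := by
  wlog hrr : r < r' ∨ r = r' ∧ c < c' ∨ t ≠ t' generalizing r c t r' c' t'
  · obtain ⟨b, hb⟩ := this hB hA hne.symm (by
      simp only [ne_eq, Prod.mk.injEq] at hne
      omega)
    exact ⟨b, hb.symm⟩
  by_cases ht : t = t'
  · subst ht
    rcases hrr with hr | ⟨rfl, hc⟩ | ht
    · by_cases hr' : r' = r + 1 ∧ c' ≤ c
      · obtain ⟨rfl, hc⟩ := hr'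
        exact ⟨_, isJoinKey_next_row hA hB hc⟩
      · exact ⟨_, isJoinKey_lower_row hA hB (by omega)⟩
    · exact ⟨_, isJoinKey_same_row hA hB hc⟩
    · exact absurd rfl ht
  · exact ⟨_, isJoinKey_of_component_ne hA hB ht⟩

end MP


/-- Let `A = (r,c,t)` and `B = (r',c',t')` be distinct Garnir nodes of
an `l`-multipartition `λ` of `n`.  Then there is a unique (as a filling of `[λ]`)
row-strict, non-standard `λ`-tableau `G = g^{A,B}` such that (1) `G ≥_L g^A` and
`G ≥_L g^B`, and (2) every row-strict `λ`-tableau `T` with `T ≥_L g^A` and `T ≥_L g^B`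
satisfies `T ≥_L G`. -/
theorem stmt6 (l n : ℕ) (hl : 1 ≤ l) (lam : ℕ → ℕ → ℕ) (hMP : IsMP l n lam)
    (r c t r' c' t' : ℕ)
    (hA : IsGarnir l lam r c t) (hB : IsGarnir l lam r' c' t')
    (hne : (r, c, t) ≠ (r', c', t')) :
    ∃ G : MNode → ℕ,
      (IsTab l n lam G ∧ RowStrict l lam G ∧ ¬ IsStd l n lam G ∧
        TabGe l n lam G (gtab n lam r c t) ∧ TabGe l n lam G (gtab n lam r' c' t') ∧
        (∀ T : MNode → ℕ, IsTab l n lam T → RowStrict l lam T →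
          TabGe l n lam T (gtab n lam r c t) → TabGe l n lam T (gtab n lam r' c' t') →
          TabGe l n lam T G)) ∧
      (∀ G' : MNode → ℕ,
        (IsTab l n lam G' ∧ RowStrict l lam G' ∧ ¬ IsStd l n lam G' ∧
          TabGe l n lam G' (gtab n lam r c t) ∧ TabGe l n lam G' (gtab n lam r' c' t') ∧
          (∀ T : MNode → ℕ, IsTab l n lam T → RowStrict l lam T →
            TabGe l n lam T (gtab n lam r c t) → TabGe l n lam T (gtab n lam r' c' t') →
            TabGe l n lam T G')) →
        Set.EqOn G' G (diag l lam)) := by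
  obtain ⟨b, hb⟩ := exists_isJoinKey hA hB hne
  have hf := blockKey_injective b
  set G := rankTab l n lam (blockKey b)
  have hG : IsTab l n lam G := hMP.isTab_rankTab hf
  have hGr : RowStrict l lam G := fun i j s _ hy => hMP.rankTab_lt hy (hb.row i j s)
  have hGA : G (r + 1, c, t) < G (r, c, t) := hMP.rankTab_lt hA.1 hb.left
  have hGB : G (r' + 1, c', t') < G (r', c', t') := hMP.rankTab_lt hB.1 hb.right
  have hleast : ∀ T : MNode → ℕ, IsTab l n lam T → RowStrict l lam T →
      TabGe l n lam T (gtab n lam r c t) → TabGe l n lam T (gtab n lam r' c' t') →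
      TabGe l n lam T G := by
    intro T hT hTr hTA hTB
    rw [hMP.tabGe_gtab_iff hA hT hTr] at hTA
    rw [hMP.tabGe_gtab_iff hB hT hTr] at hTB
    rw [hMP.tabGe_iff hT hG]
    exact fun x hx y hy hxy hlt => hb.least T hTr hTA hTB x hx y hy hxy
      ((hMP.rankTab_lt_iff hf hy hx).1 hlt)
  have hGA' := (hMP.tabGe_gtab_iff hA hG hGr).2 hGA
  have hGB' := (hMP.tabGe_gtab_iff hB hG hGr).2 hGB
  refine ⟨G, ⟨hG, hGr, fun hstd => hGA.not_gt (hstd.2.2 r c t hA.1 hA.2), hGA', hGB', hleast⟩, ?_⟩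
  rintro G' ⟨hG', hGr', -, hGA₁, hGB₁, hleast'⟩
  exact hMP.eqOn_of_tabGe hG' hG (hleast G' hG' hGr' hGA₁ hGB₁) (hleast' G hG hGr hGA' hGB')
end

section
/- Let λ = (λ_1, λ_2) be a partition of n with λ_2 > 0, with charge κ ∈ ℤ and type C_∞ residues, and let T be a row-strict λ-tableau. If res T^{-1}(n) = |κ + λ_1 − 1| and res T^{-1}(n−1) = |κ + λ_1 − 2|, then T(1, λ_1) = n. -/
/-- A node `(r, c)` of the Young diagram of a partition: row `r`, column `c`, 1-based. -/
abbrev PNode : Type := ℕ × ℕ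

namespace PT

/-- `lam r` is the length `λ_r` of the `r`-th row (1-based) of a partition of `n`. -/
def IsPartitionOf (n : ℕ) (lam : ℕ → ℕ) : Prop :=
  (∀ r, 1 ≤ r → lam (r + 1) ≤ lam r) ∧
  (∀ r, n < r → lam r = 0) ∧
  (∀ r, lam r ≤ n) ∧
  (∑ r ∈ Finset.Icc 1 n, lam r) = n

/-- The Young diagram `[λ]`. -/
def diag (lam : ℕ → ℕ) : Set PNode := {x | 1 ≤ x.1 ∧ 1 ≤ x.2 ∧ x.2 ≤ lam x.1}

/-- A `λ`-tableau: a bijection `[λ] → {1, …, n}`. -/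
def IsTab (n : ℕ) (lam : ℕ → ℕ) (T : PNode → ℕ) : Prop :=
  Set.BijOn T (diag lam) (Set.Icc 1 n)

/-- Entries increase from left to right along rows. -/
def RowStrict (lam : ℕ → ℕ) (T : PNode → ℕ) : Prop :=
  ∀ r c, (r, c) ∈ diag lam → (r, c + 1) ∈ diag lam → T (r, c) < T (r, c + 1)

/-- Entries increase down columns. -/
def ColStrict (lam : ℕ → ℕ) (T : PNode → ℕ) : Prop :=
  ∀ r c, (r, c) ∈ diag lam → (r + 1, c) ∈ diag lam → T (r, c) < T (r + 1, c)

/-- A standard `λ`-tableau. -/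
def IsStd (n : ℕ) (lam : ℕ → ℕ) (T : PNode → ℕ) : Prop :=
  IsTab n lam T ∧ RowStrict lam T ∧ ColStrict lam T

/-- The initial tableau `t^λ`, filling `1, …, n` along successive rows. -/
def itab (lam : ℕ → ℕ) (x : PNode) : ℕ :=
  (∑ r' ∈ Finset.Ico 1 x.1, lam r') + x.2

/-- `(r, c)` is a Garnir node of `[λ]`. -/
def IsGarnir (lam : ℕ → ℕ) (r c : ℕ) : Prop :=
  (r, c) ∈ diag lam ∧ (r + 1, c) ∈ diag lam

/-- The Garnir tableau `g^A` of the Garnir node `A = (r, c)`. -/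
def gtab (lam : ℕ → ℕ) (r c : ℕ) : PNode → ℕ := fun x =>
  if x.1 = r + 1 ∧ 1 ≤ x.2 ∧ x.2 ≤ c then itab lam (r, c) + (x.2 - 1)
  else if x.1 = r ∧ c ≤ x.2 then itab lam (r, c) + c + (x.2 - c)
  else itab lam x

/-- `w` is the permutation `w^T` of the tableau `T`: `w ∈ S_n` and `w t^λ = T`. -/
def PermOf (n : ℕ) (lam : ℕ → ℕ) (T : PNode → ℕ) (w : Equiv.Perm ℕ) : Prop :=
  FixOut n w ∧ ∀ x ∈ diag lam, w (itab lam x) = T x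

/-- The type-`C_∞` residue of the node `(r, c)`, for the charge `κ`. -/
def res (κ : ℤ) (x : PNode) : ℕ := (κ + (x.2 : ℤ) - (x.1 : ℤ)).natAbs

/-- A word in the simple transpositions `s_1, …, s_{n-1}`. -/
def IsWord (n : ℕ) (L : List ℕ) : Prop := ∀ i ∈ L, 1 ≤ i ∧ i + 1 ≤ n

/-- The permutation given by a word. -/
def wordProd (L : List ℕ) : Equiv.Perm ℕ := (L.map sgen).prod

/-- The Bruhat order on `S_n`: `v ≼ w` iff some reduced expression of `w` admits a
subsequence which is an expression for `v`. -/
def BruhatLe (n : ℕ) (v w : Equiv.Perm ℕ) : Prop :=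
  ∃ L M : List ℕ, IsWord n L ∧ wordProd L = w ∧ L.length = invLen n (wordProd L) ∧
    M.Sublist L ∧ wordProd M = v

/-- The dominance order on `λ`-tableaux: `T ⊵ S` iff `w^T ≼ w^S` in the Bruhat order
(`∃`-quantified over the associated permutations). -/
def TabDom (n : ℕ) (lam : ℕ → ℕ) (T S : PNode → ℕ) : Prop :=
  ∃ wT wS : Equiv.Perm ℕ, PermOf n lam T wT ∧ PermOf n lam S wS ∧ BruhatLe n wT wS

/-- The left (weak Bruhat) order: `v ≥_L w` iff `v = u w` with `ℓ(v) = ℓ(u) + ℓ(w)`. -/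
def LeftGe (n : ℕ) (v w : Equiv.Perm ℕ) : Prop :=
  ∃ u : Equiv.Perm ℕ, FixOut n u ∧ v = u * w ∧ invLen n v = invLen n u + invLen n w

/-- The left order on `λ`-tableaux. -/
def TabGe (n : ℕ) (lam : ℕ → ℕ) (T T' : PNode → ℕ) : Prop :=
  ∃ wT wT' : Equiv.Perm ℕ, PermOf n lam T wT ∧ PermOf n lam T' wT' ∧ LeftGe n wT wT'

end PT

open PT

/-- Let `λ = (λ₁, λ₂)` be a partition of `n` with `λ₂ > 0`, with charge
`κ ∈ ℤ` and type `C_∞` residues, and let `T` be a row-strict `λ`-tableau.  If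
`res T⁻¹(n) = |κ + λ₁ − 1|` and `res T⁻¹(n−1) = |κ + λ₁ − 2|`, then `T(1, λ₁) = n`. -/
theorem stmt8 (n : ℕ) (κ : ℤ) (l1 l2 : ℕ) (h21 : l2 ≤ l1) (h2 : 1 ≤ l2)
    (hsum : l1 + l2 = n)
    (lam : ℕ → ℕ) (hlam : lam = fun r => if r = 1 then l1 else if r = 2 then l2 else 0)
    (T : PNode → ℕ) (hTab : IsTab n lam T) (hRow : RowStrict lam T)
    (hres_n : ∀ x ∈ diag lam, T x = n → res κ x = (κ + (l1 : ℤ) - 1).natAbs)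
    (hres_n1 : ∀ x ∈ diag lam, T x = n - 1 → res κ x = (κ + (l1 : ℤ) - 2).natAbs) :
    T (1, l1) = n := by
  have hmem : ∀ r c, (r, c) ∈ diag lam ↔ (r = 1 ∧ 1 ≤ c ∧ c ≤ l1) ∨ (r = 2 ∧ 1 ≤ c ∧ c ≤ l2) := by
    intro r c
    simp only [diag, Set.mem_ofPred_eq, hlam]
    split_ifs <;> omega
  obtain ⟨hmaps, hinj, hsurj⟩ := hTab
  have hle : ∀ x ∈ diag lam, T x ≤ n := fun x hx => (hmaps hx).2
  obtain ⟨⟨r, c⟩, hx, hxn⟩ := hsurj (show n ∈ Set.Icc 1 n from ⟨by omega, le_rfl⟩)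
  obtain ⟨⟨r', c'⟩, hy, hyn⟩ :=
    hsurj (show n - 1 ∈ Set.Icc 1 n from ⟨by omega, by omega⟩)
  have hlast : (r, c + 1) ∉ diag lam := fun h => by
    have := hRow r c hx h
    have := hle _ h
    omega
  have hnext : (r', c' + 1) ∈ diag lam → r' = r ∧ c' + 1 = c := fun h => by
    have h1 := hRow r' c' hy h
    have h3 := hle _ h
    have h4 : T (r', c' + 1) = T (r, c) := by omega
    simpa using hinj h hx h4
  have hr := hres_n _ hx hxn
  have hr' := hres_n1 _ hy hyn
  have hne : ¬ (r' = r ∧ c' = c) := by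
    rintro ⟨rfl, rfl⟩
    omega
  simp only [res] at hr hr'
  rw [hmem] at hx hy hlast hnext
  by_cases h1 : r = 1
  · have hc : c = l1 := by
      clear hr hr'
      omega
    exact h1 ▸ hc ▸ hxn
  · have hpos : r = 2 ∧ c = l2 ∧ (r' = 1 ∧ c' = l1 ∨ r' = 2 ∧ c' + 1 = l2) := by
      clear hr hr'
      have hr2 : r = 2 := by omega
      have hc : c = l2 := by omega
      subst hr2 hc
      refine ⟨rfl, rfl, ?_⟩
      by_cases h3 : r' = 1
      · subst h3
        omega
      · have h4 : r' = 2 := by omega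
        subst h4
        omega
    clear hx hy hlast hnext hne
    obtain ⟨rfl, rfl, ⟨rfl, rfl⟩ | ⟨rfl, rfl⟩⟩ := hpos
    · omega
    · omega
end

section
/- Let λ = (λ_1, λ_2, λ_3) be a partition of n with λ_3 > 0, with charge κ ∈ ℤ and type C_∞ residues, and let T be a row-strict λ-tableau. Suppose that: res T^{-1}(n) = |κ + λ_1 − 1|, res T^{-1}(n−1) = |κ + λ_1 − 2|, and res T^{-1}(n−2) = |κ + λ_1 − 3|; and that res(3, λ_3) ≠ res(1, λ_2), i.e. |κ + λ_3 − 3| ≠ |κ + λ_2 − 1|. Then T(1, λ_1) = n. -/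
open PT

/-- A node of the diagram is the last one of its row, or it has a right neighbour, which carries
a larger entry of a row-strict tableau. -/
theorem PT.RowStrict.eq_row_end_or_lt_right {lam : ℕ → ℕ} {T : PNode → ℕ}
    (hRow : RowStrict lam T) {r c : ℕ} (h : (r, c) ∈ diag lam) :
    c = lam r ∨ (r, c + 1) ∈ diag lam ∧ T (r, c) < T (r, c + 1) := by
  obtain ⟨h1, h2, h3⟩ := h
  rcases h3.eq_or_lt with h3 | h3
  · exact Or.inl h3
  · have h' : (r, c + 1) ∈ diag lam := ⟨h1, by simp, h3⟩
    exact Or.inr ⟨h', hRow r c ⟨h1, h2, h3.le⟩ h'⟩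

/-- If the three nodes containing the largest entries of a row-strict tableau are `(r, c)`,
`(r', c')` and `(r'', c'')`, each of them is the last node of its row once the larger entries
are removed. -/
theorem PT.RowStrict.removable_of_largest {n : ℕ} {lam : ℕ → ℕ} {T : PNode → ℕ}
    (hTab : IsTab n lam T) (hRow : RowStrict lam T) (hn : 3 ≤ n) {r c r' c' r'' c'' : ℕ}
    (hx : (r, c) ∈ diag lam) (hTx : T (r, c) = n)
    (hy : (r', c') ∈ diag lam) (hTy : T (r', c') = n - 1)
    (hz : (r'', c'') ∈ diag lam) (hTz : T (r'', c'') = n - 2) :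
    c = lam r ∧
    (r' ≠ r ∧ c' = lam r' ∨ r' = r ∧ c' + 1 = c) ∧
    (r'' ≠ r ∧ r'' ≠ r' ∧ c'' = lam r'' ∨ r'' = r ∧ c'' + 1 = c ∨ r'' = r' ∧ c'' + 1 = c') := by
  have h_end : c = lam r := by
    rcases hRow.eq_row_end_or_lt_right hx with h | ⟨h, hlt⟩
    · exact h
    · have := (hTab.mapsTo h).2
      omega
  have h_end' : r' ≠ r ∧ c' = lam r' ∨ r' = r ∧ c' + 1 = c := by
    rcases hRow.eq_row_end_or_lt_right hy with h | ⟨h, hlt⟩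
    · refine Or.inl ⟨?_, h⟩
      rintro rfl
      rw [h, ← h_end] at hTy
      omega
    · have := (hTab.mapsTo h).2
      exact Or.inr (by simpa using hTab.injOn h hx (by omega))
  refine ⟨h_end, h_end', ?_⟩
  rcases hRow.eq_row_end_or_lt_right hz with h | ⟨h, hlt⟩
  · refine Or.inl ⟨?_, ?_, h⟩
    · rintro rfl
      rw [h, ← h_end] at hTz
      omega
    · rintro rfl
      rcases h_end' with ⟨-, h'⟩ | ⟨rfl, -⟩
      · rw [h, ← h'] at hTz
        omega
      · rw [h, ← h_end] at hTz
        omega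
  · have := (hTab.mapsTo h).2
    rcases (show T (r'', c'' + 1) = n ∨ T (r'', c'' + 1) = n - 1 by omega) with h' | h'
    · exact Or.inr (Or.inl (by simpa using hTab.injOn h hx (by omega)))
    · exact Or.inr (Or.inr (by simpa using hTab.injOn h hy (by omega)))

/-- Let `λ = (λ₁, λ₂, λ₃)` be a partition of `n` with `λ₃ > 0`, with
charge `κ ∈ ℤ` and type `C_∞` residues, and let `T` be a row-strict `λ`-tableau.
Suppose `res T⁻¹(n) = |κ + λ₁ − 1|`, `res T⁻¹(n−1) = |κ + λ₁ − 2|`,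
`res T⁻¹(n−2) = |κ + λ₁ − 3|`, and `|κ + λ₃ − 3| ≠ |κ + λ₂ − 1|`.
Then `T(1, λ₁) = n`. -/
theorem stmt9 (n : ℕ) (κ : ℤ) (l1 l2 l3 : ℕ)
    (h21 : l2 ≤ l1) (h32 : l3 ≤ l2) (h3 : 1 ≤ l3) (hsum : l1 + l2 + l3 = n)
    (lam : ℕ → ℕ)
    (hlam : lam = fun r => if r = 1 then l1 else if r = 2 then l2 else if r = 3 then l3 else 0)
    (T : PNode → ℕ) (hTab : IsTab n lam T) (hRow : RowStrict lam T)
    (hres_n : ∀ x ∈ diag lam, T x = n → res κ x = (κ + (l1 : ℤ) - 1).natAbs)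
    (hres_n1 : ∀ x ∈ diag lam, T x = n - 1 → res κ x = (κ + (l1 : ℤ) - 2).natAbs)
    (hres_n2 : ∀ x ∈ diag lam, T x = n - 2 → res κ x = (κ + (l1 : ℤ) - 3).natAbs)
    (hres33 : (κ + (l3 : ℤ) - 3).natAbs ≠ (κ + (l2 : ℤ) - 1).natAbs) :
    T (1, l1) = n := by
  obtain ⟨⟨r, c⟩, hx, hTx⟩ := hTab.surjOn (show n ∈ Set.Icc 1 n from ⟨by omega, le_rfl⟩)
  obtain ⟨⟨r', c'⟩, hy, hTy⟩ :=
    hTab.surjOn (show n - 1 ∈ Set.Icc 1 n from ⟨by omega, by omega⟩)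
  obtain ⟨⟨r'', c''⟩, hz, hTz⟩ :=
    hTab.surjOn (show n - 2 ∈ Set.Icc 1 n from ⟨by omega, by omega⟩)
  obtain ⟨hpx, hpy, hpz⟩ :=
    hRow.removable_of_largest hTab (by omega) hx hTx hy hTy hz hTz
  have h_row : ∀ r c, (r, c) ∈ diag lam → r = 1 ∨ r = 2 ∨ r = 3 := by
    rintro r c ⟨h1, h2, h3⟩
    subst hlam
    dsimp only at h1 h2 h3
    split_ifs at h3 <;> omega
  have hl1 : lam 1 = l1 := by simp [hlam]
  have hl2 : lam 2 = l2 := by simp [hlam]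
  have hl3 : lam 3 = l3 := by simp [hlam]
  have h_res := hres_n _ hx hTx
  have h_res' := hres_n1 _ hy hTy
  have h_res'' := hres_n2 _ hz hTz
  simp only [res, Int.natAbs_eq_natAbs_iff] at h_res h_res' h_res''
  rw [Ne, Int.natAbs_eq_natAbs_iff] at hres33
  have hr := h_row _ _ hx
  have hr' := h_row _ _ hy
  have hr'' := h_row _ _ hz
  clear hres_n hres_n1 hres_n2 hTab hRow hTy hTz hx hy hz h_row hlam
  rcases hr with rfl | rfl | rfl
  · rwa [hpx, hl1] at hTx
  · have hκ : κ + l2 - 2 = -(κ + l1 - 1) := by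
      clear h_res' h_res'' hpy hpz hres33
      omega
    clear h_res h_res'' hpz hres33
    rcases hr' with rfl | rfl | rfl <;> omega
  · have hκ : κ + l3 - 3 = -(κ + l1 - 1) := by
      clear h_res' h_res'' hpy hpz hres33
      omega
    clear h_res
    rcases hr' with rfl | rfl | rfl
    · clear h_res'' hpz hres33
      omega
    · have hκ' : κ + l2 - 2 = -(κ + l1 - 2) ∧ 2 ≤ κ + l1 - 1 := by
        clear h_res'' hpz
        omega
      clear h_res' hres33
      rcases hr'' with rfl | rfl | rfl <;> omega
    · clear h_res'' hpz hres33
      omega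
end

section
/- Let λ be a partition of n with charge κ ∈ ℤ and type C_∞ residues, and let A = (r,c) be a Garnir node of [λ]. Then there is no row-strict λ-tableau T with T ⊳ g^A and res T = res g^A. -/
open PT

/-- The inversions of `w` among `1, …, n`. -/
def invSet (n : ℕ) (w : Equiv.Perm ℕ) : Finset (ℕ × ℕ) :=
  (Finset.Icc 1 n ×ˢ Finset.Icc 1 n).filter fun p => p.1 < p.2 ∧ w p.2 < w p.1

theorem sgen_apply (i m : ℕ) :
    sgen i m = if m = i then i + 1 else if m = i + 1 then i else m :=
  Equiv.swap_apply_def i (i + 1) m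

theorem wordProd_cons (i : ℕ) (L : List ℕ) : wordProd (i :: L) = sgen i * wordProd L := by
  simp [wordProd]

theorem invSet_sgen_mul_subset (n i : ℕ) (w : Equiv.Perm ℕ) :
    invSet n (sgen i * w) ⊆ insert (w.symm i, w.symm (i + 1)) (invSet n w) := by
  rintro ⟨a, b⟩ h
  rw [invSet, Finset.mem_filter] at h
  simp only [invSet, Finset.mem_insert, Finset.mem_filter, Prod.mk.injEq, Equiv.eq_symm_apply,
    Equiv.Perm.mul_apply] at h ⊢
  obtain ⟨hn, hab, hw⟩ := h
  have hne : w a ≠ w b := fun h => hab.ne (w.injective h)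
  by_cases hlt : w b < w a
  · exact Or.inr ⟨hn, hab, hlt⟩
  · left
    rw [sgen_apply, sgen_apply] at hw
    split_ifs at hw <;> omega

theorem invLen_sgen_mul_le (n i : ℕ) (w : Equiv.Perm ℕ) :
    invLen n (sgen i * w) ≤ invLen n w + 1 :=
  (Finset.card_le_card (invSet_sgen_mul_subset n i w)).trans (Finset.card_insert_le _ _)

theorem invSet_sgen_mul_of_lt {n i : ℕ} {w : Equiv.Perm ℕ}
    (h : invLen n w < invLen n (sgen i * w)) :
    invSet n (sgen i * w) = insert (w.symm i, w.symm (i + 1)) (invSet n w) :=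
  Finset.eq_of_subset_of_card_le (invSet_sgen_mul_subset n i w)
    ((Finset.card_insert_le _ _).trans h)

theorem invLen_wordProd_le (n : ℕ) (L : List ℕ) : invLen n (wordProd L) ≤ L.length := by
  induction L with
  | nil =>
    rw [List.length_nil, Nat.le_zero, invLen, Finset.card_eq_zero, Finset.filter_eq_empty_iff]
    rintro p - ⟨h, h'⟩
    exact lt_asymm h h'
  | cons i L ih =>
    rw [wordProd_cons, List.length_cons]
    exact (invLen_sgen_mul_le n i _).trans (Nat.succ_le_succ ih)

theorem wordProd_le_iff {L : List ℕ} {i : ℕ} (hi : i ∉ L) (m : ℕ) :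
    wordProd L m ≤ i ↔ m ≤ i := by
  induction L with
  | nil => rfl
  | cons j L ih =>
    rw [List.mem_cons, not_or] at hi
    rw [← ih hi.2, wordProd_cons, Equiv.Perm.mul_apply, sgen_apply]
    split_ifs <;> omega

/-- A reduced word containing `i` has an inversion straddling `i`. -/
theorem exists_inversion_of_mem {n : ℕ} {L : List ℕ} (hL : L.length = invLen n (wordProd L))
    {i : ℕ} (hi : i ∈ L) : ∃ a b, a ≤ i ∧ i < b ∧ wordProd L b < wordProd L a := by
  suffices h : ∃ p ∈ invSet n (wordProd L), p.1 ≤ i ∧ i < p.2 by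
    obtain ⟨p, hp, h1, h2⟩ := h
    exact ⟨p.1, p.2, h1, h2, (Finset.mem_filter.1 hp).2.2⟩
  induction L with
  | nil => simp at hi
  | cons j L ih =>
    rw [wordProd_cons, List.length_cons] at hL
    rw [wordProd_cons]
    have h1 := invLen_wordProd_le n L
    have h2 := invLen_sgen_mul_le n j (wordProd L)
    rw [invSet_sgen_mul_of_lt (by omega)]
    by_cases hmem : i ∈ L
    · obtain ⟨p, hp, h⟩ := ih (by omega) hmem
      exact ⟨p, Finset.mem_insert_of_mem hp, h⟩
    · obtain rfl : i = j := (List.mem_cons.1 hi).resolve_right hmem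
      refine ⟨_, Finset.mem_insert_self _ _, ?_, ?_⟩
      · rw [← wordProd_le_iff hmem, Equiv.apply_symm_apply]
      · rw [← not_le, ← wordProd_le_iff hmem, Equiv.apply_symm_apply]
        omega

/-- Every letter of a reduced word of a permutation supported on `[u, v]` lies in `[u, v)`. -/
theorem mem_Ico_of_mem_reduced {n u v : ℕ} {L : List ℕ}
    (hL : L.length = invLen n (wordProd L))
    (hfix : ∀ m, m ∉ Set.Icc u v → wordProd L m = m) {i : ℕ} (hi : i ∈ L) : u ≤ i ∧ i < v := by
  obtain ⟨a, b, ha, hb, hw⟩ := exists_inversion_of_mem hL hi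
  constructor
  · by_contra! hlt
    have h1 := hfix a (fun h => by have := h.1; omega)
    have h2 := (wordProd L).injective
      (hfix (wordProd L b) (fun h => by have := h.1; omega))
    omega
  · by_contra! hlt
    have h1 := hfix b (fun h => by have := h.2; omega)
    have h2 := (wordProd L).injective
      (hfix (wordProd L a) (fun h => by have := h.2; omega))
    omega

theorem wordProd_apply_of_notMem {u v : ℕ} {L : List ℕ} (hL : ∀ i ∈ L, u ≤ i ∧ i < v)
    {m : ℕ} (hm : m ∉ Set.Icc u v) : wordProd L m = m := by
  induction L with
  | nil => rfl
  | cons j L ih =>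
    rw [wordProd_cons, Equiv.Perm.mul_apply, ih fun i hi => hL i (List.mem_cons_of_mem _ hi),
      sgen_apply]
    have := hL j List.mem_cons_self
    rw [Set.mem_Icc] at hm
    split_ifs <;> omega

/-- Below `w` in the Bruhat order, supports in an interval are inherited. -/
theorem PT.BruhatLe.apply_of_notMem {n u v : ℕ} {x w : Equiv.Perm ℕ} (h : BruhatLe n x w)
    (hfix : ∀ m, m ∉ Set.Icc u v → w m = m) {m : ℕ} (hm : m ∉ Set.Icc u v) : x m = m := by
  obtain ⟨L, M, -, rfl, hred, hsub, rfl⟩ := h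
  exact wordProd_apply_of_notMem
    (fun i hi => mem_Ico_of_mem_reduced hred hfix (hsub.subset hi)) hm

theorem sum_Ico_one_mono (lam : ℕ → ℕ) {a b : ℕ} (h : a ≤ b) :
    ∑ r ∈ Finset.Ico 1 a, lam r ≤ ∑ r ∈ Finset.Ico 1 b, lam r :=
  Finset.sum_le_sum_of_subset (Finset.Ico_subset_Ico_right h)

theorem sum_Ico_one_succ (lam : ℕ → ℕ) {a : ℕ} (h : 1 ≤ a) :
    ∑ r ∈ Finset.Ico 1 (a + 1), lam r = ∑ r ∈ Finset.Ico 1 a, lam r + lam a :=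
  Finset.sum_Ico_succ_top h _

theorem exists_itab_eq {n : ℕ} {lam : ℕ → ℕ} (hsum : ∑ r ∈ Finset.Icc 1 n, lam r = n)
    {m : ℕ} (hm : m ∈ Set.Icc 1 n) : ∃ x ∈ diag lam, itab lam x = m := by
  have hex : ∃ R, m ≤ ∑ r ∈ Finset.Ico 1 (R + 1), lam r :=
    ⟨n, by rw [Finset.Ico_add_one_right_eq_Icc, hsum]; exact hm.2⟩
  obtain ⟨R, hR, hmin⟩ : ∃ R, m ≤ ∑ r ∈ Finset.Ico 1 (R + 1), lam r ∧
      ∀ Q < R, ¬ m ≤ ∑ r ∈ Finset.Ico 1 (Q + 1), lam r :=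
    ⟨Nat.find hex, Nat.find_spec hex, fun _ => Nat.find_min hex⟩
  have hm1 : 1 ≤ m := hm.1
  obtain _ | Q := R
  · simp at hR
    omega
  · have hQ := hmin Q (Nat.lt_succ_self Q)
    rw [sum_Ico_one_succ lam (Nat.le_add_left 1 Q)] at hR
    refine ⟨(Q + 1, m - ∑ r ∈ Finset.Ico 1 (Q + 1), lam r),
      ⟨Nat.le_add_left 1 Q, ?_, ?_⟩, ?_⟩ <;> simp only [itab] <;> omega

theorem itab_garnir_succ {lam : ℕ → ℕ} {r : ℕ} (hr : 1 ≤ r) (c : ℕ) :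
    itab lam (r + 1, c) = itab lam (r, c) + lam r := by
  simp only [itab]
  rw [sum_Ico_one_succ lam hr]
  omega

theorem gtab_of_itab_notMem {lam : ℕ → ℕ} {r c : ℕ} (hA : IsGarnir lam r c)
    {x : PNode} (hx : x ∈ diag lam)
    (h : itab lam x ∉ Set.Icc (itab lam (r, c)) (itab lam (r + 1, c))) :
    gtab lam r c x = itab lam x := by
  obtain ⟨a, b⟩ := x
  obtain ⟨⟨hr, hc, hcr⟩, -, -, hcr'⟩ := hA
  obtain ⟨ha, hb, hba⟩ := hx
  have hs := sum_Ico_one_succ lam hr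
  simp only [gtab, itab, Set.mem_Icc] at *
  split_ifs with h1 h2
  · obtain ⟨rfl, h1⟩ := h1
    omega
  · obtain ⟨rfl, h2⟩ := h2
    omega
  · rfl

theorem itab_notMem_of_notMem_belt {lam : ℕ → ℕ} {r c a b : ℕ} (hA : IsGarnir lam r c)
    (hx : (a, b) ∈ diag lam) (h1 : ¬ (a = r + 1 ∧ b ≤ c)) (h2 : ¬ (a = r ∧ c ≤ b)) :
    itab lam (a, b) ∉ Set.Icc (itab lam (r, c)) (itab lam (r + 1, c)) := by
  obtain ⟨⟨hr, hc, hcr⟩, hr', -, hcr'⟩ := hA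
  obtain ⟨ha, hb, hba⟩ := hx
  have hs := sum_Ico_one_succ lam hr
  have hs' := sum_Ico_one_succ lam (Nat.le_add_left 1 r)
  have hs'' := sum_Ico_one_succ lam ha
  simp only [itab, Set.mem_Icc] at *
  rcases lt_trichotomy a r with hlt | rfl | hgt
  · have : _ ≤ ∑ r' ∈ Finset.Ico 1 r, lam r' := sum_Ico_one_mono lam (a := a + 1) hlt
    omega
  · omega
  · obtain rfl | hgt' : a = r + 1 ∨ r + 1 + 1 ≤ a := by omega
    · omega
    · have := sum_Ico_one_mono lam hgt'
      omega

theorem PT.RowStrict.lt {lam : ℕ → ℕ} {T : PNode → ℕ} (hT : RowStrict lam T) {a b b' : ℕ}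
    (hb : (a, b) ∈ diag lam) (hb' : (a, b') ∈ diag lam) (h : b < b') : T (a, b) < T (a, b') := by
  induction b', h using Nat.le_induction with
  | base => exact hT a b hb hb'
  | succ d hd ih =>
    have hmem : (a, d) ∈ diag lam := by
      obtain ⟨h1, h2, -⟩ := hb
      obtain ⟨-, -, h3⟩ := hb'
      simp only [diag, Set.mem_ofPred_eq] at *
      omega
    have hlt := hT a d hmem hb'
    exact (ih hmem).trans hlt

/-- A shuffle of two consecutive intervals which preserves `i ↦ |k + i|` is trivial. -/
theorem shuffle_eq_self {N c : ℕ} {k : ℤ} {τ : ℕ → ℕ} (hmaps : ∀ i ≤ N, τ i ≤ N)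
    (hinj : ∀ i ≤ N, ∀ j ≤ N, τ i = τ j → i = j)
    (hfst : ∀ i j, i < j → j < c → j ≤ N → τ i < τ j)
    (hsnd : ∀ i j, c ≤ i → i < j → j ≤ N → τ i < τ j)
    (hres : ∀ i ≤ N, (k + i).natAbs = (k + τ i).natAbs) : ∀ i ≤ N, τ i = i := by
  have key : ∀ i j, i < j → j ≤ N → τ i = j → τ j = i → False := by
    intro i j hij hj h1 h2
    have hi := hres i (by omega)
    rw [h1] at hi
    obtain ⟨m, hm⟩ : ∃ m : ℕ, (m : ℤ) = -k := ⟨(-k).toNat, by omega⟩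
    have hmm := hres m (by omega)
    have hfix : τ m = m := by omega
    rcases lt_or_ge m c with hc | hc
    · have := hfst i m (by omega) hc (by omega)
      omega
    · have := hsnd m j hc (by omega) hj
      omega
  intro i hi
  by_contra hne
  have h1 := hres i hi
  have h2 := hres (τ i) (hmaps i hi)
  have h3 : τ (τ i) ≠ τ i := fun h => hne (hinj _ (hmaps i hi) _ hi h)
  have h4 : τ (τ i) = i := by omega
  rcases lt_or_gt_of_ne hne with h | h
  · exact key (τ i) i h hi h4 rfl
  · exact key i (τ i) h (hmaps i hi) rfl h4

/-- The node of the Garnir belt carrying the `i`-th entry (from `0`) in the Garnir tableau. -/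
def beltNode (r c i : ℕ) : PNode := if i < c then (r + 1, i + 1) else (r, i)

theorem beltNode_mem_diag {lam : ℕ → ℕ} {r c : ℕ} (hA : IsGarnir lam r c) {i : ℕ}
    (hi : i ≤ lam r) : beltNode r c i ∈ diag lam := by
  obtain ⟨⟨hr, hc, hcr⟩, hr', -, hcr'⟩ := hA
  unfold beltNode
  split_ifs <;> simp only [diag, Set.mem_ofPred_eq] at * <;> omega

theorem gtab_beltNode (lam : ℕ → ℕ) (r c i : ℕ) :
    gtab lam r c (beltNode r c i) = itab lam (r, c) + i := by
  simp only [beltNode, gtab]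
  split_ifs <;> simp_all

theorem res_beltNode (κ : ℤ) (r c i : ℕ) :
    res κ (beltNode r c i) = (κ - r + i).natAbs := by
  simp only [beltNode, res]
  split_ifs <;> push_cast <;> congr 1 <;> ring

theorem itab_beltNode_mem {lam : ℕ → ℕ} {r c : ℕ} (hA : IsGarnir lam r c) {i : ℕ}
    (hi : i ≤ lam r) :
    itab lam (beltNode r c i) ∈ Set.Icc (itab lam (r, c)) (itab lam (r + 1, c)) := by
  have hr : 1 ≤ r := hA.1.1
  have hs := sum_Ico_one_succ lam hr
  have hc : c ≤ lam r := hA.1.2.2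
  simp only [beltNode]
  split_ifs <;> simp only [itab, Set.mem_Icc] <;> omega

theorem beltNode_injective (r c : ℕ) : Function.Injective (beltNode r c) := by
  intro i j h
  simp only [beltNode] at h
  split_ifs at h <;> simp only [Prod.mk.injEq] at h <;> omega

theorem gtab_eqOn_of_res_eq {n : ℕ} {κ : ℤ} {lam : ℕ → ℕ} (hP : IsPartitionOf n lam)
    {r c : ℕ} (hA : IsGarnir lam r c) {T : PNode → ℕ} (hT : IsTab n lam T)
    (hrow : RowStrict lam T) (hdom : TabDom n lam T (gtab lam r c))
    (hres : ∀ x ∈ diag lam, ∀ y ∈ diag lam, T x = gtab lam r c y → res κ x = res κ y) :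
    Set.EqOn T (gtab lam r c) (diag lam) := by
  obtain ⟨wT, wS, hwT, hwS, hle⟩ := hdom
  have hr : 1 ≤ r := hA.1.1
  set u := itab lam (r, c) with hu
  have hv : itab lam (r + 1, c) = u + lam r := itab_garnir_succ hr c
  have hfixS : ∀ m, m ∉ Set.Icc u (itab lam (r + 1, c)) → wS m = m := by
    intro m hm
    by_cases hmn : m ∈ Set.Icc 1 n
    · obtain ⟨x, hx, rfl⟩ := exists_itab_eq hP.2.2.2 hmn
      rw [hwS.2 x hx, gtab_of_itab_notMem hA hx hm]
    · exact hwS.1 m hmn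
  have hfixT : ∀ m, m ∉ Set.Icc u (itab lam (r + 1, c)) → wT m = m :=
    fun m hm => hle.apply_of_notMem hfixS hm
  have hbelt : ∀ i ≤ lam r, u ≤ T (beltNode r c i) ∧ T (beltNode r c i) ≤ u + lam r := by
    intro i hi
    have hmem := itab_beltNode_mem hA hi
    by_contra hcon
    rw [← hv, ← Set.mem_Icc, ← hwT.2 _ (beltNode_mem_diag hA hi)] at hcon
    rw [wT.injective (hfixT _ hcon)] at hcon
    exact hcon hmem
  have hτ : ∀ i ≤ lam r, u + (T (beltNode r c i) - u) = T (beltNode r c i) :=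
    fun i hi => Nat.add_sub_cancel' (hbelt i hi).1
  have hmono : ∀ i j, i ≤ lam r → j ≤ lam r → T (beltNode r c i) < T (beltNode r c j) →
      T (beltNode r c i) - u < T (beltNode r c j) - u := by
    intro i j hi hj h
    have := hτ i hi
    have := hτ j hj
    omega
  have hid := shuffle_eq_self (N := lam r) (c := c) (k := κ - r)
    (τ := fun i => T (beltNode r c i) - u)
    (fun i hi => by have := hbelt i hi; omega)
    (fun i hi j hj h => beltNode_injective r c <|
      hT.injOn (beltNode_mem_diag hA hi) (beltNode_mem_diag hA hj) <| by
        rw [← hτ i hi, ← hτ j hj]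
        exact congrArg (u + ·) h)
    (fun i j hij hjc hj => hmono i j (hij.le.trans hj) hj <| by
      have h1 := beltNode_mem_diag hA (hij.le.trans hj)
      have h2 := beltNode_mem_diag hA hj
      simp only [beltNode, if_pos hjc, if_pos (hij.trans hjc)] at h1 h2 ⊢
      exact hrow.lt h1 h2 (Nat.succ_lt_succ hij))
    (fun i j hci hij hj => hmono i j (hij.le.trans hj) hj <| by
      have h1 := beltNode_mem_diag hA (hij.le.trans hj)
      have h2 := beltNode_mem_diag hA hj
      simp only [beltNode, if_neg hci.not_gt, if_neg (hci.trans hij.le).not_gt] at h1 h2 ⊢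
      exact hrow.lt h1 h2 hij)
    (fun i hi => by
      have hle' : T (beltNode r c i) - u ≤ lam r := by have := hbelt i hi; omega
      have := hres _ (beltNode_mem_diag hA hi) _ (beltNode_mem_diag hA hle')
        (by rw [gtab_beltNode, hτ i hi])
      rwa [res_beltNode, res_beltNode] at this)
  have hTbelt : ∀ i ≤ lam r, T (beltNode r c i) = gtab lam r c (beltNode r c i) := by
    intro i hi
    rw [gtab_beltNode, ← hτ i hi]
    exact congrArg (u + ·) (hid i hi)
  rintro ⟨a, b⟩ hx
  by_cases h1 : a = r + 1 ∧ b ≤ c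
  · obtain ⟨rfl, hbc⟩ := h1
    have hb : 1 ≤ b := hx.2.1
    have hc : c ≤ lam r := hA.1.2.2
    have h := hTbelt (b - 1) (by omega)
    rwa [beltNode, if_pos (by omega), Nat.sub_add_cancel hb] at h
  by_cases h2 : a = r ∧ c ≤ b
  · obtain ⟨rfl, hcb⟩ := h2
    have h := hTbelt b hx.2.2
    rwa [beltNode, if_neg hcb.not_gt] at h
  have hnot := itab_notMem_of_notMem_belt hA hx h1 h2
  rw [gtab_of_itab_notMem hA hx hnot, ← hwT.2 _ hx, hfixT _ hnot]

/-- Let `λ` be a partition of `n` with charge `κ ∈ ℤ` and type `C_∞`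
residues, and let `A = (r,c)` be a Garnir node of `[λ]`.  Then there is no row-strict
`λ`-tableau `T` with `T ⊳ g^A` and `res T = res g^A`. -/
theorem stmt10 (n : ℕ) (κ : ℤ) (lam : ℕ → ℕ) (hP : IsPartitionOf n lam)
    (r c : ℕ) (hA : IsGarnir lam r c) :
    ¬ ∃ T : PNode → ℕ,
      IsTab n lam T ∧ RowStrict lam T ∧
      TabDom n lam T (gtab lam r c) ∧
      ¬ Set.EqOn T (gtab lam r c) (diag lam) ∧
      (∀ x ∈ diag lam, ∀ y ∈ diag lam, T x = gtab lam r c y → res κ x = res κ y) := by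
  rintro ⟨T, hT, hrow, hdom, hne, hres⟩
  exact hne (gtab_eqOn_of_res_eq hP hA hT hrow hdom hres)
end
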